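/- The flow rewriting system c is terminating on the set of cycle-free atomic flows: there is no infinite chain A₁ →_c A₂ →_c A₃ →_c ⋯ with A₁ cycle-free. -/

import Mathlib

set_option linter.unusedVariables false

namespace AF

/-! ### Formulae of system SKS.

Atoms are pairs `(n, b)`; the involution `ā` flips the Boolean, so it is
fixed-point free. -/

inductive Formula : Type
  | tt : Formula
  | ff : Formula
  | atom : ℕ → Bool → Formula
  | or : Formula → Formula → Formula
  | and : Formula → Formula → Formula
  deriving DecidableEq

namespace Formula

/-- Subformula at a position (`false` = left child, `true` = right child). -/
def sub : Formula → List Bool → Option Formula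
  | φ, [] => some φ
  | .or α _, false :: p => sub α p
  | .or _ β, true :: p => sub β p
  | .and α _, false :: p => sub α p
  | .and _ β, true :: p => sub β p
  | _, _ :: _ => none

/-- Replace the subformula at a position. -/
def repl : Formula → List Bool → Formula → Formula
  | _, [], ψ => ψ
  | .or α β, false :: p, ψ => .or (repl α p ψ) β
  | .or α β, true :: p, ψ => .or α (repl β p ψ)
  | .and α β, false :: p, ψ => .and (repl α p ψ) β
  | .and α β, true :: p, ψ => .and α (repl β p ψ)
  | φ, _ :: _, _ => φ

/-- `p` is an atom occurrence of `φ`. -/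
def IsOcc (φ : Formula) (p : List Bool) : Prop :=
  ∃ n b, φ.sub p = some (.atom n b)

end Formula

/-! ### Inference rules.

The rule `=` of SKS replaces a formula by an equivalent one under
commutativity, associativity and the unit equations; each single instance of
`=` applies one equation (in either direction), so we list the equations as
individual rule names, all marked as being instances of `=` via `isEq`. -/

inductive RuleName : Type
  | aiDown | aiUp | awDown | awUp | acDown | acUp
  | s | m
  | eqOrComm | eqAndComm
  | eqOrAssocL | eqOrAssocR | eqAndAssocL | eqAndAssocR
  | eqOrUnitDel | eqOrUnitAdd | eqAndUnitDel | eqAndUnitAdd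
  | eqTTDel | eqTTAdd | eqFFDel | eqFFAdd
  deriving DecidableEq

namespace RuleName

/-- The atomic structural rules. -/
def isStructural : RuleName → Bool
  | .aiDown | .aiUp | .awDown | .awUp | .acDown | .acUp => true
  | _ => false

/-- The rule names that are instances of the rule `=`. -/
def isEq : RuleName → Bool
  | .aiDown | .aiUp | .awDown | .awUp | .acDown | .acUp | .s | .m => false
  | _ => true

end RuleName

/-- Rule instances (redex ⟹ contractum). -/
inductive RuleInstance : RuleName → Formula → Formula → Prop
  | aiDown (n : ℕ) (b : Bool) :
      RuleInstance .aiDown .tt (.or (.atom n b) (.atom n (!b)))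
  | aiUp (n : ℕ) (b : Bool) :
      RuleInstance .aiUp (.and (.atom n b) (.atom n (!b))) .ff
  | awDown (n : ℕ) (b : Bool) : RuleInstance .awDown .ff (.atom n b)
  | awUp (n : ℕ) (b : Bool) : RuleInstance .awUp (.atom n b) .tt
  | acDown (n : ℕ) (b : Bool) :
      RuleInstance .acDown (.or (.atom n b) (.atom n b)) (.atom n b)
  | acUp (n : ℕ) (b : Bool) :
      RuleInstance .acUp (.atom n b) (.and (.atom n b) (.atom n b))
  | s (α β γ : Formula) :
      RuleInstance .s (.and α (.or β γ)) (.or (.and α β) γ)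
  | m (α β γ δ : Formula) :
      RuleInstance .m (.or (.and α β) (.and γ δ)) (.and (.or α γ) (.or β δ))
  | eqOrComm (α β : Formula) : RuleInstance .eqOrComm (.or α β) (.or β α)
  | eqAndComm (α β : Formula) : RuleInstance .eqAndComm (.and α β) (.and β α)
  | eqOrAssocL (α β γ : Formula) :
      RuleInstance .eqOrAssocL (.or (.or α β) γ) (.or α (.or β γ))
  | eqOrAssocR (α β γ : Formula) :
      RuleInstance .eqOrAssocR (.or α (.or β γ)) (.or (.or α β) γ)
  | eqAndAssocL (α β γ : Formula) :
      RuleInstance .eqAndAssocL (.and (.and α β) γ) (.and α (.and β γ))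
  | eqAndAssocR (α β γ : Formula) :
      RuleInstance .eqAndAssocR (.and α (.and β γ)) (.and (.and α β) γ)
  | eqOrUnitDel (α : Formula) : RuleInstance .eqOrUnitDel (.or α .ff) α
  | eqOrUnitAdd (α : Formula) : RuleInstance .eqOrUnitAdd α (.or α .ff)
  | eqAndUnitDel (α : Formula) : RuleInstance .eqAndUnitDel (.and α .tt) α
  | eqAndUnitAdd (α : Formula) : RuleInstance .eqAndUnitAdd α (.and α .tt)
  | eqTTDel : RuleInstance .eqTTDel (.or .tt .tt) .tt
  | eqTTAdd : RuleInstance .eqTTAdd .tt (.or .tt .tt)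
  | eqFFDel : RuleInstance .eqFFDel (.and .ff .ff) .ff
  | eqFFAdd : RuleInstance .eqFFAdd .ff (.and .ff .ff)

/-- One (deep) inference step applying rule `r` at position `q`. -/
def StepAt (r : RuleName) (q : List Bool) (φ ψ : Formula) : Prop :=
  ∃ γ δ, φ.sub q = some γ ∧ RuleInstance r γ δ ∧ ψ = φ.repl q δ

/-- One inference step using a rule from the set `S`. -/
def Step (S : Set RuleName) (φ ψ : Formula) : Prop :=
  ∃ r ∈ S, ∃ q, StepAt r q φ ψ

/-- There is a derivation from `φ` to `ψ` using only rules from `S`. -/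
def Derives (S : Set RuleName) : Formula → Formula → Prop :=
  Relation.ReflTransGen (Step S)

/-! ### Derivations as explicit data (for the theory of atomic flows). -/

/-- A derivation: a premiss and a chain of steps, each recorded by its rule
name, the position of the redex, and the resulting formula. -/
structure Deriv : Type where
  prem : Formula
  steps : List (RuleName × List Bool × Formula)

namespace Deriv

/-- The `i`-th step datum. -/
def stepAt (Φ : Deriv) (i : ℕ) : RuleName × List Bool × Formula :=
  Φ.steps.getD i (RuleName.s, ([] : List Bool), Formula.tt)

/-- The `i`-th formula of the derivation (`0` is the premiss). -/
def fml (Φ : Deriv) (i : ℕ) : Formula :=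
  (Φ.prem :: Φ.steps.map (fun t => t.2.2)).getD i Φ.prem

/-- Number of formulae in the derivation. -/
def nf (Φ : Deriv) : ℕ := Φ.steps.length + 1

/-- The conclusion of the derivation. -/
def concl (Φ : Deriv) : Formula := Φ.fml Φ.steps.length

/-- The derivation is well formed: every recorded step is a correct
inference step of SKS. -/
def WF (Φ : Deriv) : Prop :=
  ∀ i, i < Φ.steps.length →
    StepAt (Φ.stepAt i).1 (Φ.stepAt i).2.1 (Φ.fml i) (Φ.fml (i + 1))

end Deriv

/-! ### Atomic flows. -/

inductive FlowLabel : Type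
  | aiDown | aiUp | awDown | awUp | acDown | acUp
  deriving DecidableEq

/-- Required (number of lower edges, number of upper edges) of a vertex. -/
def labDeg : FlowLabel → ℕ × ℕ
  | .aiDown => (2, 0)
  | .aiUp => (0, 2)
  | .awDown => (1, 0)
  | .awUp => (0, 1)
  | .acDown => (1, 2)
  | .acUp => (2, 1)

/-- The data of an atomic flow: vertices, edges, labels, and the two
endpoint maps.  `up e = none` means the upper endpoint is `⊤`, and
`lo e = none` means the lower endpoint is `⊥`. -/
structure PreFlow : Type where
  V : Finset ℕ
  E : Finset ℕ
  η : ℕ → FlowLabel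
  up : ℕ → Option ℕ
  lo : ℕ → Option ℕ

namespace PreFlow

/-- Lower edges of a vertex. -/
def Ledges (F : PreFlow) (v : ℕ) : Finset ℕ :=
  F.E.filter (fun e => F.up e = some v)

/-- Upper edges of a vertex. -/
def Uedges (F : PreFlow) (v : ℕ) : Finset ℕ :=
  F.E.filter (fun e => F.lo e = some v)

/-- All edges of a vertex. -/
def edges (F : PreFlow) (v : ℕ) : Finset ℕ := F.Ledges v ∪ F.Uedges v

def degOK (F : PreFlow) : Prop :=
  ∀ v ∈ F.V, (F.Ledges v).card = (labDeg (F.η v)).1 ∧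
    (F.Uedges v).card = (labDeg (F.η v)).2

def endpointsOK (F : PreFlow) : Prop :=
  ∀ e ∈ F.E, (∀ v, F.up e = some v → v ∈ F.V) ∧
    (∀ v, F.lo e = some v → v ∈ F.V)

/-- No cyclic sequence of edges `ε₁, …, ε_h` with
`up (ε_i) = lo (ε_(i+1 mod h))`. -/
def Acyclic (F : PreFlow) : Prop :=
  ¬ ∃ (h : ℕ) (ε : Fin (h + 1) → ℕ), (∀ i, ε i ∈ F.E) ∧
      ∀ i : Fin (h + 1), (F.up (ε i)).isSome ∧ F.up (ε i) = F.lo (ε (i + 1))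

/-- `π` is a polarity assignment (`false` = `−`, `true` = `+`). -/
def PolarityOK (F : PreFlow) (π : ℕ → Bool) : Prop :=
  ∀ v ∈ F.V,
    ((F.η v = .acDown ∨ F.η v = .acUp) →
      ∀ e₁ ∈ F.edges v, ∀ e₂ ∈ F.edges v, π e₁ = π e₂) ∧
    ((F.η v = .aiDown ∨ F.η v = .aiUp) →
      ∃ e₁ ∈ F.edges v, ∃ e₂ ∈ F.edges v, π e₁ ≠ π e₂)

/-- `F` is an atomic flow. -/
def IsFlow (F : PreFlow) : Prop :=
  F.degOK ∧ F.endpointsOK ∧ F.Acyclic ∧ ∃ π, F.PolarityOK π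

end PreFlow

/-! ### Paths, ai-paths, cycles. -/

/-- An endpoint of a path: a vertex, or `⊤`, or `⊥`. -/
inductive VPt : Type
  | ver : ℕ → VPt
  | top : VPt
  | bot : VPt
  deriving DecidableEq

/-- The upper endpoint of edge `e` is `ν`. -/
def srcOK (F : PreFlow) (ν : VPt) (e : ℕ) : Prop :=
  match ν with
  | .ver v => F.up e = some v
  | .top => F.up e = none
  | .bot => False

/-- The lower endpoint of edge `e` is `ν`. -/
def tgtOK (F : PreFlow) (ν : VPt) (e : ℕ) : Prop :=
  match ν with
  | .ver v => F.lo e = some v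
  | .bot => F.lo e = none
  | .top => False

/-- A downward path from `ν` to `ν'` (a nonempty sequence of edges, each
hanging from the lower endpoint of the previous one). -/
def IsDownPath (F : PreFlow) (ν ν' : VPt) (l : List ℕ) : Prop :=
  l ≠ [] ∧ (∀ e ∈ l, e ∈ F.E) ∧
  (∀ i, i + 1 < l.length →
    ∃ v ∈ F.V, F.lo (l.getD i 0) = some v ∧ F.up (l.getD (i + 1) 0) = some v) ∧
  srcOK F ν (l.getD 0 0) ∧ tgtOK F ν' (l.getD (l.length - 1) 0)

/-- A path from `ν` to `ν'`: a downward path, or the reverse of a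
downward path from `ν'` to `ν`. -/
def IsPath (F : PreFlow) (ν ν' : VPt) (l : List ℕ) : Prop :=
  IsDownPath F ν ν' l ∨ IsDownPath F ν' ν l.reverse

/-- ai-paths: paths, closed under concatenation (in distinct edges) at
interaction and cointeraction vertices. -/
inductive AIPath (F : PreFlow) : VPt → VPt → List ℕ → Prop
  | single {ν ν' : VPt} {l : List ℕ} : IsPath F ν ν' l → AIPath F ν ν' l
  | join {ν ν' : VPt} {v : ℕ} {l₁ l₂ : List ℕ} {e e' : ℕ} :
      v ∈ F.V → (F.η v = .aiDown ∨ F.η v = .aiUp) →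
      AIPath F ν (.ver v) (l₁ ++ [e]) →
      AIPath F (.ver v) ν' (e' :: l₂) →
      e ≠ e' →
      AIPath F ν ν' (l₁ ++ [e] ++ e' :: l₂)

/-- The flow contains an ai-cycle: an ai-path from a vertex to itself in
which no edge appears twice. -/
def HasAICycle (F : PreFlow) : Prop :=
  ∃ v l, v ∈ F.V ∧ AIPath F (.ver v) (.ver v) l ∧ l.Nodup

def CycleFree (F : PreFlow) : Prop := ¬ HasAICycle F

/-- An ai-connection: a path from an interaction vertex to a cointeraction
vertex or vice versa. -/
def IsConnection (F : PreFlow) (l : List ℕ) : Prop :=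
  ∃ v v', v ∈ F.V ∧ v' ∈ F.V ∧
    ((F.η v = .aiDown ∧ F.η v' = .aiUp) ∨
     (F.η v = .aiUp ∧ F.η v' = .aiDown)) ∧
    IsPath F (.ver v) (.ver v') l

/-- A simple edge: an ai-connection consisting of a single edge. -/
def SimpleEdge (F : PreFlow) (e : ℕ) : Prop := IsConnection F [e]

/-- A clean path: an ai-path all of whose ai-connections are simple edges. -/
def IsCleanPath (F : PreFlow) (ν ν' : VPt) (l : List ℕ) : Prop :=
  AIPath F ν ν' l ∧
  ∀ l₁ l₂ l₃, l = l₁ ++ l₂ ++ l₃ → IsConnection F l₂ → l₂.length = 1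

/-! ### Local flow reduction rules. -/

open PreFlow

/-- Rule `w↓-c↓`: a weakening feeding a contraction is erased, merging the
contraction's other two edges. -/
def RedWdCd (A B : PreFlow) : Prop :=
  ∃ v₁ v₂ e e₂ e₃,
    v₁ ∈ A.V ∧ v₂ ∈ A.V ∧ v₁ ≠ v₂ ∧
    A.η v₁ = .awDown ∧ A.η v₂ = .acDown ∧
    e ∈ A.E ∧ e₂ ∈ A.E ∧ e₃ ∈ A.E ∧ e ≠ e₂ ∧ e ≠ e₃ ∧ e₂ ≠ e₃ ∧
    A.up e = some v₁ ∧ A.lo e = some v₂ ∧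
    A.lo e₂ = some v₂ ∧ A.up e₃ = some v₂ ∧
    B.V = (A.V.erase v₁).erase v₂ ∧
    B.E = (A.E.erase e).erase e₃ ∧
    B.η = A.η ∧ B.up = A.up ∧
    B.lo = Function.update A.lo e₂ (A.lo e₃)

/-- Rule `c↑-w↑` (dual of `w↓-c↓`). -/
def RedCuWu (A B : PreFlow) : Prop :=
  ∃ v₁ v₂ e e₂ e₃,
    v₁ ∈ A.V ∧ v₂ ∈ A.V ∧ v₁ ≠ v₂ ∧
    A.η v₁ = .awUp ∧ A.η v₂ = .acUp ∧
    e ∈ A.E ∧ e₂ ∈ A.E ∧ e₃ ∈ A.E ∧ e ≠ e₂ ∧ e ≠ e₃ ∧ e₂ ≠ e₃ ∧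
    A.lo e = some v₁ ∧ A.up e = some v₂ ∧
    A.up e₂ = some v₂ ∧ A.lo e₃ = some v₂ ∧
    B.V = (A.V.erase v₁).erase v₂ ∧
    B.E = (A.E.erase e).erase e₃ ∧
    B.η = A.η ∧ B.lo = A.lo ∧
    B.up = Function.update A.up e₂ (A.up e₃)

/-- Rule `w↓-i↑`: a weakening feeding a cointeraction is replaced by a
coweakening on the other cointeraction edge. -/
def RedWdIu (A B : PreFlow) : Prop :=
  ∃ v₁ v₂ e e₂,
    v₁ ∈ A.V ∧ v₂ ∈ A.V ∧ v₁ ≠ v₂ ∧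
    A.η v₁ = .awDown ∧ A.η v₂ = .aiUp ∧
    e ∈ A.E ∧ e₂ ∈ A.E ∧ e ≠ e₂ ∧
    A.up e = some v₁ ∧ A.lo e = some v₂ ∧ A.lo e₂ = some v₂ ∧
    B.V = A.V.erase v₁ ∧ B.E = A.E.erase e ∧
    B.η = Function.update A.η v₂ .awUp ∧
    B.up = A.up ∧ B.lo = A.lo

/-- Rule `i↓-w↑` (dual of `w↓-i↑`). -/
def RedIdWu (A B : PreFlow) : Prop :=
  ∃ v₁ v₂ e e₂,
    v₁ ∈ A.V ∧ v₂ ∈ A.V ∧ v₁ ≠ v₂ ∧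
    A.η v₁ = .awUp ∧ A.η v₂ = .aiDown ∧
    e ∈ A.E ∧ e₂ ∈ A.E ∧ e ≠ e₂ ∧
    A.lo e = some v₁ ∧ A.up e = some v₂ ∧ A.up e₂ = some v₂ ∧
    B.V = A.V.erase v₁ ∧ B.E = A.E.erase e ∧
    B.η = Function.update A.η v₂ .awDown ∧
    B.up = A.up ∧ B.lo = A.lo

/-- Rule `w↓-w↑`: a weakening joined to a coweakening is erased. -/
def RedWdWu (A B : PreFlow) : Prop :=
  ∃ v₁ v₂ e,
    v₁ ∈ A.V ∧ v₂ ∈ A.V ∧ v₁ ≠ v₂ ∧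
    A.η v₁ = .awDown ∧ A.η v₂ = .awUp ∧
    e ∈ A.E ∧ A.up e = some v₁ ∧ A.lo e = some v₂ ∧
    B.V = (A.V.erase v₁).erase v₂ ∧ B.E = A.E.erase e ∧
    B.η = A.η ∧ B.up = A.up ∧ B.lo = A.lo

/-- Rule `w↓-c↑`: a weakening feeding a cocontraction is replaced by two
weakenings. -/
def RedWdCu (A B : PreFlow) : Prop :=
  ∃ v₁ v₂ e e₁ e₂,
    v₁ ∈ A.V ∧ v₂ ∈ A.V ∧ v₁ ≠ v₂ ∧
    A.η v₁ = .awDown ∧ A.η v₂ = .acUp ∧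
    e ∈ A.E ∧ e₁ ∈ A.E ∧ e₂ ∈ A.E ∧ e ≠ e₁ ∧ e ≠ e₂ ∧ e₁ ≠ e₂ ∧
    A.up e = some v₁ ∧ A.lo e = some v₂ ∧
    A.up e₁ = some v₂ ∧ A.up e₂ = some v₂ ∧
    B.V = A.V ∧ B.E = A.E.erase e ∧
    B.η = Function.update A.η v₂ .awDown ∧
    B.up = Function.update A.up e₁ (some v₁) ∧
    B.lo = A.lo

/-- Rule `c↓-w↑` (dual of `w↓-c↑`). -/
def RedCdWu (A B : PreFlow) : Prop :=
  ∃ v₁ v₂ e e₁ e₂,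
    v₁ ∈ A.V ∧ v₂ ∈ A.V ∧ v₁ ≠ v₂ ∧
    A.η v₁ = .awUp ∧ A.η v₂ = .acDown ∧
    e ∈ A.E ∧ e₁ ∈ A.E ∧ e₂ ∈ A.E ∧ e ≠ e₁ ∧ e ≠ e₂ ∧ e₁ ≠ e₂ ∧
    A.lo e = some v₁ ∧ A.up e = some v₂ ∧
    A.lo e₁ = some v₂ ∧ A.lo e₂ = some v₂ ∧
    B.V = A.V ∧ B.E = A.E.erase e ∧
    B.η = Function.update A.η v₂ .awUp ∧
    B.lo = Function.update A.lo e₁ (some v₁) ∧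
    B.up = A.up

/-- Rule `c↓-i↑`: a contraction whose output edge enters a cointeraction is
replaced by a cocontraction on the other cointeraction edge followed by two
cointeractions. -/
def RedCdIu (A B : PreFlow) : Prop :=
  ∃ v₁ v₂ v₃ e e₁ e₂ e₃ g₁ g₂,
    v₁ ∈ A.V ∧ v₂ ∈ A.V ∧ v₁ ≠ v₂ ∧ v₃ ∉ A.V ∧
    A.η v₁ = .acDown ∧ A.η v₂ = .aiUp ∧
    e ∈ A.E ∧ e₁ ∈ A.E ∧ e₂ ∈ A.E ∧ e₃ ∈ A.E ∧
    e ≠ e₁ ∧ e ≠ e₂ ∧ e ≠ e₃ ∧ e₁ ≠ e₂ ∧ e₁ ≠ e₃ ∧ e₂ ≠ e₃ ∧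
    g₁ ∉ A.E ∧ g₂ ∉ A.E ∧ g₁ ≠ g₂ ∧
    A.lo e₁ = some v₁ ∧ A.lo e₂ = some v₁ ∧
    A.up e = some v₁ ∧ A.lo e = some v₂ ∧ A.lo e₃ = some v₂ ∧
    B.V = insert v₃ A.V ∧
    B.E = insert g₁ (insert g₂ (A.E.erase e)) ∧
    B.η = Function.update (Function.update A.η v₁ .acUp) v₃ .aiUp ∧
    B.up = Function.update (Function.update A.up g₁ (some v₁)) g₂ (some v₁) ∧
    B.lo = Function.update (Function.update (Function.update
      (Function.update (Function.update A.lo e₁ (some v₂)) e₂ (some v₃))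
        e₃ (some v₁)) g₁ (some v₂)) g₂ (some v₃)

/-- Rule `i↓-c↑` (dual of `c↓-i↑`). -/
def RedIdCu (A B : PreFlow) : Prop :=
  ∃ v₁ v₂ v₃ e e₁ e₂ e₃ g₁ g₂,
    v₁ ∈ A.V ∧ v₂ ∈ A.V ∧ v₁ ≠ v₂ ∧ v₃ ∉ A.V ∧
    A.η v₁ = .acUp ∧ A.η v₂ = .aiDown ∧
    e ∈ A.E ∧ e₁ ∈ A.E ∧ e₂ ∈ A.E ∧ e₃ ∈ A.E ∧
    e ≠ e₁ ∧ e ≠ e₂ ∧ e ≠ e₃ ∧ e₁ ≠ e₂ ∧ e₁ ≠ e₃ ∧ e₂ ≠ e₃ ∧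
    g₁ ∉ A.E ∧ g₂ ∉ A.E ∧ g₁ ≠ g₂ ∧
    A.up e₁ = some v₁ ∧ A.up e₂ = some v₁ ∧
    A.lo e = some v₁ ∧ A.up e = some v₂ ∧ A.up e₃ = some v₂ ∧
    B.V = insert v₃ A.V ∧
    B.E = insert g₁ (insert g₂ (A.E.erase e)) ∧
    B.η = Function.update (Function.update A.η v₁ .acDown) v₃ .aiDown ∧
    B.lo = Function.update (Function.update A.lo g₁ (some v₁)) g₂ (some v₁) ∧
    B.up = Function.update (Function.update (Function.update
      (Function.update (Function.update A.up e₁ (some v₂)) e₂ (some v₃))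
        e₃ (some v₁)) g₁ (some v₂)) g₂ (some v₃)

/-- Rule `c↓-c↑`: a contraction whose output enters a cocontraction is
replaced by two cocontractions above two contractions, crosswise connected. -/
def RedCdCu (A B : PreFlow) : Prop :=
  ∃ v₁ v₂ v₃ v₄ e e₁ e₂ e₃ e₄ g₁₁ g₁₂ g₂₁ g₂₂,
    v₁ ∈ A.V ∧ v₂ ∈ A.V ∧ v₁ ≠ v₂ ∧
    v₃ ∉ A.V ∧ v₄ ∉ A.V ∧ v₃ ≠ v₄ ∧
    A.η v₁ = .acDown ∧ A.η v₂ = .acUp ∧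
    e ∈ A.E ∧ e₁ ∈ A.E ∧ e₂ ∈ A.E ∧ e₃ ∈ A.E ∧ e₄ ∈ A.E ∧
    e ≠ e₁ ∧ e ≠ e₂ ∧ e ≠ e₃ ∧ e ≠ e₄ ∧
    e₁ ≠ e₂ ∧ e₁ ≠ e₃ ∧ e₁ ≠ e₄ ∧ e₂ ≠ e₃ ∧ e₂ ≠ e₄ ∧ e₃ ≠ e₄ ∧
    g₁₁ ∉ A.E ∧ g₁₂ ∉ A.E ∧ g₂₁ ∉ A.E ∧ g₂₂ ∉ A.E ∧
    g₁₁ ≠ g₁₂ ∧ g₁₁ ≠ g₂₁ ∧ g₁₁ ≠ g₂₂ ∧ g₁₂ ≠ g₂₁ ∧ g₁₂ ≠ g₂₂ ∧ g₂₁ ≠ g₂₂ ∧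
    A.lo e₁ = some v₁ ∧ A.lo e₂ = some v₁ ∧ A.up e = some v₁ ∧
    A.lo e = some v₂ ∧ A.up e₃ = some v₂ ∧ A.up e₄ = some v₂ ∧
    B.V = insert v₃ (insert v₄ A.V) ∧
    B.E = insert g₁₁ (insert g₁₂ (insert g₂₁ (insert g₂₂ (A.E.erase e)))) ∧
    B.η = Function.update (Function.update (Function.update
      (Function.update A.η v₁ .acUp) v₂ .acUp) v₃ .acDown) v₄ .acDown ∧
    B.up = Function.update (Function.update (Function.update
      (Function.update (Function.update (Function.update A.up
        e₃ (some v₃)) e₄ (some v₄)) g₁₁ (some v₁)) g₁₂ (some v₁))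
          g₂₁ (some v₂)) g₂₂ (some v₂) ∧
    B.lo = Function.update (Function.update (Function.update
      (Function.update (Function.update A.lo e₂ (some v₂)) g₁₁ (some v₃))
        g₁₂ (some v₄)) g₂₁ (some v₃)) g₂₂ (some v₄)

/-- One step of the flow rewriting system `w`. -/
def StepW (A B : PreFlow) : Prop :=
  RedWdCd A B ∨ RedCuWu A B ∨ RedWdIu A B ∨ RedIdWu A B ∨
  RedWdWu A B ∨ RedWdCu A B ∨ RedCdWu A B

/-- One step of the flow rewriting system `c`. -/
def StepC (A B : PreFlow) : Prop :=
  RedCdIu A B ∨ RedIdCu A B ∨ RedCdCu A B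

/-- `A` is normal for the flow rewriting system `w`. -/
def NormalW (A : PreFlow) : Prop := ¬ ∃ B, StepW A B

/-- `A` is normal for the flow rewriting system `c`. -/
def NormalC (A : PreFlow) : Prop := ¬ ∃ B, StepC A B

/-! ### Flow isomorphisms. -/

structure FlowIso (A B : PreFlow) : Type where
  vmap : ℕ → ℕ
  emap : ℕ → ℕ
  vbij : Set.BijOn vmap (A.V : Set ℕ) (B.V : Set ℕ)
  ebij : Set.BijOn emap (A.E : Set ℕ) (B.E : Set ℕ)
  lab : ∀ v ∈ A.V, B.η (vmap v) = A.η v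
  upc : ∀ e ∈ A.E, B.up (emap e) = (A.up e).map vmap
  loc : ∀ e ∈ A.E, B.lo (emap e) = (A.lo e).map vmap

/-! ### The global reduction `→se` (elimination of a simple edge). -/

/-- The flow obtained from `B` by eliminating the simple edge `e0` between
the interaction `vi` and the cointeraction `vc` (with `e2` the other lower
edge of `vi` and `e3` the other upper edge of `vc`): two copies (tags `0`,
hat, the lower one, and `1`, tilde, the upper one) of the remaining flow are
glued by identifying the hat copy of `e2` with the tilde copy of `e3`; a
weakening (vertex `(2,0)`) is placed above the tilde copy of `e2`, a
coweakening (vertex `(2,1)`) below the hat copy of `e3`; each upper edge `ε`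
of `B` gives a cocontraction (vertex `(3,ε)`, with a new upper edge `(3,ε)`)
joining the two copies of `ε`, and dually each lower edge `ε'` of `B` gives
a contraction (vertex `(4,ε')`, with a new lower edge `(4,ε')`). -/
def seFlow (B : PreFlow) (vi vc e0 e2 e3 : ℕ) : PreFlow :=
  { V := ((B.V.erase vi).erase vc).image (Nat.pair 0) ∪
         ((B.V.erase vi).erase vc).image (Nat.pair 1) ∪
         {Nat.pair 2 0, Nat.pair 2 1} ∪
         (B.E.filter (fun e => B.up e = none)).image (Nat.pair 3) ∪
         (B.E.filter (fun e => B.lo e = none)).image (Nat.pair 4),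
    E := (B.E.erase e0).image (Nat.pair 0) ∪
         (B.E.erase e0).image (fun e => if e = e3 then Nat.pair 0 e2 else Nat.pair 1 e) ∪
         (B.E.filter (fun e => B.up e = none)).image (Nat.pair 3) ∪
         (B.E.filter (fun e => B.lo e = none)).image (Nat.pair 4),
    η := fun x =>
      if (Nat.unpair x).1 = 2 then
        (if (Nat.unpair x).2 = 0 then FlowLabel.awDown else FlowLabel.awUp)
      else if (Nat.unpair x).1 = 3 then FlowLabel.acUp
      else if (Nat.unpair x).1 = 4 then FlowLabel.acDown
      else B.η (Nat.unpair x).2,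
    up := fun x =>
      let t := (Nat.unpair x).1
      let y := (Nat.unpair x).2
      if t = 0 then
        (if y = e2 then
          (match B.up e3 with
           | some v => some (Nat.pair 1 v)
           | none => some (Nat.pair 3 e3))
        else
          (match B.up y with
           | some v => some (Nat.pair 0 v)
           | none => some (Nat.pair 3 y)))
      else if t = 1 then
        (if y = e2 then some (Nat.pair 2 0)
        else
          (match B.up y with
           | some v => some (Nat.pair 1 v)
           | none => some (Nat.pair 3 y)))
      else if t = 3 then none
      else some (Nat.pair 4 y),
    lo := fun x =>
      let t := (Nat.unpair x).1
      let y := (Nat.unpair x).2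
      if t = 0 then
        (if y = e2 then
          (match B.lo e2 with
           | some v => some (Nat.pair 0 v)
           | none => some (Nat.pair 4 e2))
        else if y = e3 then some (Nat.pair 2 1)
        else
          (match B.lo y with
           | some v => some (Nat.pair 0 v)
           | none => some (Nat.pair 4 y)))
      else if t = 1 then
        (match B.lo y with
         | some v => some (Nat.pair 1 v)
         | none => some (Nat.pair 4 y))
      else if t = 3 then some (Nat.pair 3 y)
      else none }

/-- The reduction `→se`: elimination of a simple edge (up to flow
isomorphism). -/
def RedSE (B C : PreFlow) : Prop :=
  ∃ vi vc e0 e2 e3,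
    vi ∈ B.V ∧ vc ∈ B.V ∧ vi ≠ vc ∧
    B.η vi = .aiDown ∧ B.η vc = .aiUp ∧
    e0 ∈ B.E ∧ e2 ∈ B.E ∧ e3 ∈ B.E ∧
    e0 ≠ e2 ∧ e0 ≠ e3 ∧ e2 ≠ e3 ∧
    B.up e0 = some vi ∧ B.lo e0 = some vc ∧
    B.up e2 = some vi ∧ B.lo e3 = some vc ∧
    Nonempty (FlowIso C (seFlow B vi vc e0 e2 e3))

/-! ### The atomic flow associated with a derivation. -/

/-- Correspondence conditions for a linear rule applied at position `q`:
for each pair `(c₁, c₂)` in `cs`, occurrences at `q ++ c₁ ++ p` in the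
conclusion (formula `i+1`) are traced to occurrences at `q ++ c₂ ++ p` in
the premiss (formula `i`). -/
def corrCond (f : ℕ → List Bool → ℕ) (i : ℕ) (q : List Bool) (ψ : Formula)
    (cs : List (List Bool × List Bool)) : Prop :=
  ∀ c ∈ cs, ∀ p : List Bool, ψ.IsOcc (q ++ c.1 ++ p) →
    f (i + 1) (q ++ c.1 ++ p) = f i (q ++ c.2 ++ p)

/-- The tracing conditions for one inference step: occurrences in the
context are traced to the same edge, and the active occurrences of a
structural rule are related to the edges of the vertex `v` as prescribed by
its label, while the active occurrences of logical and `=` steps are traced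
to the same edges under the canonical correspondence. -/
def stepCond (A : PreFlow) (f : ℕ → List Bool → ℕ) (v : ℕ) (i : ℕ)
    (r : RuleName) (q : List Bool) (φ ψ : Formula) : Prop :=
  (∀ p, ¬ (q <+: p) → φ.IsOcc p → f (i + 1) p = f i p) ∧
  match r with
  | .aiDown =>
      A.η v = .aiDown ∧
      A.up (f (i + 1) (q ++ [false])) = some v ∧
      A.up (f (i + 1) (q ++ [true])) = some v ∧
      f (i + 1) (q ++ [false]) ≠ f (i + 1) (q ++ [true])
  | .aiUp =>
      A.η v = .aiUp ∧
      A.lo (f i (q ++ [false])) = some v ∧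
      A.lo (f i (q ++ [true])) = some v ∧
      f i (q ++ [false]) ≠ f i (q ++ [true])
  | .awDown => A.η v = .awDown ∧ A.up (f (i + 1) q) = some v
  | .awUp => A.η v = .awUp ∧ A.lo (f i q) = some v
  | .acDown =>
      A.η v = .acDown ∧
      A.lo (f i (q ++ [false])) = some v ∧
      A.lo (f i (q ++ [true])) = some v ∧
      A.up (f (i + 1) q) = some v ∧
      f i (q ++ [false]) ≠ f i (q ++ [true])
  | .acUp =>
      A.η v = .acUp ∧
      A.lo (f i q) = some v ∧
      A.up (f (i + 1) (q ++ [false])) = some v ∧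
      A.up (f (i + 1) (q ++ [true])) = some v ∧
      f (i + 1) (q ++ [false]) ≠ f (i + 1) (q ++ [true])
  | .s => corrCond f i q ψ
      [([false, false], [false]), ([false, true], [true, false]),
       ([true], [true, true])]
  | .m => corrCond f i q ψ
      [([false, false], [false, false]), ([true, false], [false, true]),
       ([false, true], [true, false]), ([true, true], [true, true])]
  | .eqOrComm => corrCond f i q ψ [([false], [true]), ([true], [false])]
  | .eqAndComm => corrCond f i q ψ [([false], [true]), ([true], [false])]
  | .eqOrAssocL => corrCond f i q ψ
      [([false], [false, false]), ([true, false], [false, true]),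
       ([true, true], [true])]
  | .eqOrAssocR => corrCond f i q ψ
      [([false, false], [false]), ([false, true], [true, false]),
       ([true], [true, true])]
  | .eqAndAssocL => corrCond f i q ψ
      [([false], [false, false]), ([true, false], [false, true]),
       ([true, true], [true])]
  | .eqAndAssocR => corrCond f i q ψ
      [([false, false], [false]), ([false, true], [true, false]),
       ([true], [true, true])]
  | .eqOrUnitDel => corrCond f i q ψ [([], [false])]
  | .eqOrUnitAdd => corrCond f i q ψ [([false], [])]
  | .eqAndUnitDel => corrCond f i q ψ [([], [false])]
  | .eqAndUnitAdd => corrCond f i q ψ [([false], [])]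
  | .eqTTDel => True
  | .eqTTAdd => True
  | .eqFFDel => True
  | .eqFFAdd => True

/-- `A` is the atomic flow associated with the derivation `Φ`, where `f`
maps each atom occurrence (formula index, position) of `Φ` to an edge of
`A`, and `g` assigns to each structural inference step its vertex. -/
def IsAssocFlow (Φ : Deriv) (A : PreFlow) (f : ℕ → List Bool → ℕ)
    (g : ℕ → ℕ) : Prop :=
  Φ.WF ∧ A.IsFlow ∧
  (∀ i p, i < Φ.nf → (Φ.fml i).IsOcc p → f i p ∈ A.E) ∧
  (∀ e ∈ A.E, ∃ i p, i < Φ.nf ∧ (Φ.fml i).IsOcc p ∧ f i p = e) ∧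
  (∀ i p p', i < Φ.nf → (Φ.fml i).IsOcc p → (Φ.fml i).IsOcc p' →
    f i p = f i p' → p = p') ∧
  (∀ p, (Φ.fml 0).IsOcc p → A.up (f 0 p) = none) ∧
  (∀ p, (Φ.fml Φ.steps.length).IsOcc p → A.lo (f Φ.steps.length p) = none) ∧
  (∀ i, i < Φ.steps.length → (Φ.stepAt i).1.isStructural = true → g i ∈ A.V) ∧
  (∀ v ∈ A.V, ∃ i, i < Φ.steps.length ∧
    (Φ.stepAt i).1.isStructural = true ∧ g i = v) ∧
  (∀ i j, i < Φ.steps.length → j < Φ.steps.length →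
    (Φ.stepAt i).1.isStructural = true → (Φ.stepAt j).1.isStructural = true →
    g i = g j → i = j) ∧
  (∀ i, i < Φ.steps.length →
    stepCond A f (g i) i (Φ.stepAt i).1 (Φ.stepAt i).2.1
      (Φ.fml i) (Φ.fml (i + 1)))

/-! ### Streamlining. -/

/-- No path from an interaction or weakening vertex to a cointeraction or
coweakening vertex. -/
def NoIWPath (A : PreFlow) : Prop :=
  ¬ ∃ v v' l, v ∈ A.V ∧ v' ∈ A.V ∧
      (A.η v = .aiDown ∨ A.η v = .awDown) ∧
      (A.η v' = .aiUp ∨ A.η v' = .awUp) ∧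
      IsPath A (.ver v) (.ver v') l

/-- `Φ` is a streamlined derivation. -/
def Streamlined (Φ : Deriv) : Prop :=
  ∃ A f g, IsAssocFlow Φ A f g ∧ NoIWPath A

/-- `Φ` is a super-streamlined derivation. -/
def SuperStreamlined (Φ : Deriv) : Prop :=
  ∃ A f g, IsAssocFlow Φ A f g ∧ NoIWPath A ∧ NormalW A

/-- `Φ` is a hyper-streamlined derivation. -/
def HyperStreamlined (Φ : Deriv) : Prop :=
  ∃ A f g, IsAssocFlow Φ A f g ∧ NoIWPath A ∧ NormalW A ∧ NormalC A

end AF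

namespace AF

/-- Two edges `a`, `b` flow together into `c`. -/
def MergeAt (z q : ℕ → ℕ) (a b c : ℕ) : Prop :=
  z c = z a + z b + 1 ∧ q a = q c ∧ q b = q c

/-- The edge `c` flows into both `a` and `b`. -/
def SplitAt (z q : ℕ → ℕ) (c a b : ℕ) : Prop :=
  z a = z c ∧ z b = z c ∧ q c = q a + q b

/-- The edge `a` flows into `b` through an interaction or cointeraction. -/
def TurnAt (z q : ℕ → ℕ) (a b : ℕ) : Prop :=
  z b = 2 * z a + 1 ∧ q b = q a

/-- Orient positive edges downwards and negative edges upwards. The values `z` propagate forwards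
through the vertex `v`, the values `q` propagate backwards. -/
structure IsWeightedAt (F : PreFlow) (π : ℕ → Bool) (z q : ℕ → ℕ) (v : ℕ) : Prop where
  acDown : F.η v = .acDown → ∃ a ∈ F.E, ∃ b ∈ F.E, ∃ c ∈ F.E, a ≠ b ∧
    F.lo a = some v ∧ F.lo b = some v ∧ F.up c = some v ∧ π a = π c ∧ π b = π c ∧
    (π c = true → MergeAt z q a b c) ∧ (π c = false → SplitAt z q c a b)
  acUp : F.η v = .acUp → ∃ a ∈ F.E, ∃ b ∈ F.E, ∃ c ∈ F.E, a ≠ b ∧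
    F.up a = some v ∧ F.up b = some v ∧ F.lo c = some v ∧ π a = π c ∧ π b = π c ∧
    (π c = false → MergeAt z q a b c) ∧ (π c = true → SplitAt z q c a b)
  aiDown : F.η v = .aiDown → ∃ a ∈ F.E, ∃ b ∈ F.E,
    F.up a = some v ∧ F.up b = some v ∧ π a = false ∧ π b = true ∧ TurnAt z q a b
  aiUp : F.η v = .aiUp → ∃ a ∈ F.E, ∃ b ∈ F.E,
    F.lo a = some v ∧ F.lo b = some v ∧ π a = true ∧ π b = false ∧ TurnAt z q a b

/-- A weighting of a flow: the values `z` and `q` are related by the local rules at every vertex,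
and the values `q` are positive. -/
structure IsWeighting (F : PreFlow) (π : ℕ → Bool) (z q : ℕ → ℕ) : Prop where
  pos : ∀ e ∈ F.E, 0 < q e
  weightedAt : ∀ v ∈ F.V, IsWeightedAt F π z q v

/-- The oriented edge `e` enters an interaction, a cointeraction, or a vertex where the flow
splits. -/
def Active (F : PreFlow) (π : ℕ → Bool) (e : ℕ) : Prop :=
  (π e = true ∧ ∃ v, F.lo e = some v ∧ (F.η v = .aiUp ∨ F.η v = .acUp)) ∨
  (π e = false ∧ ∃ v, F.up e = some v ∧ (F.η v = .aiDown ∨ F.η v = .acDown))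

open Classical in
/-- The contribution of an edge to the termination measure. -/
noncomputable def edgeWeight (F : PreFlow) (π : ℕ → Bool) (z q : ℕ → ℕ) (e : ℕ) : ℕ :=
  if Active F π e then z e * q e else 0

/-- The termination measure. -/
noncomputable def weight (F : PreFlow) (π : ℕ → Bool) (z q : ℕ → ℕ) : ℕ :=
  ∑ e ∈ F.E, edgeWeight F π z q e

theorem PreFlow.degOK.eq_or_eq_of_lo {F : PreFlow} (h : F.degOK) {v : ℕ} (hv : v ∈ F.V)
    (h2 : (labDeg (F.η v)).2 = 2) {a b x : ℕ} (ha : a ∈ F.E) (hb : b ∈ F.E) (hx : x ∈ F.E)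
    (hab : a ≠ b) (la : F.lo a = some v) (lb : F.lo b = some v) (lx : F.lo x = some v) :
    x = a ∨ x = b := by
  have hc := (h v hv).2
  rw [h2, Finset.card_eq_two] at hc
  obtain ⟨s, t, hst, hU⟩ := hc
  have key : ∀ y ∈ F.E, F.lo y = some v → y = s ∨ y = t := fun y hy ly => by
    have : y ∈ F.Uedges v := Finset.mem_filter.2 ⟨hy, ly⟩
    simpa [hU] using this
  grind

theorem PreFlow.degOK.eq_or_eq_of_up {F : PreFlow} (h : F.degOK) {v : ℕ} (hv : v ∈ F.V)
    (h2 : (labDeg (F.η v)).1 = 2) {a b x : ℕ} (ha : a ∈ F.E) (hb : b ∈ F.E) (hx : x ∈ F.E)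
    (hab : a ≠ b) (la : F.up a = some v) (lb : F.up b = some v) (lx : F.up x = some v) :
    x = a ∨ x = b := by
  have hc := (h v hv).1
  rw [h2, Finset.card_eq_two] at hc
  obtain ⟨s, t, hst, hU⟩ := hc
  have key : ∀ y ∈ F.E, F.up y = some v → y = s ∨ y = t := fun y hy ly => by
    have : y ∈ F.Ledges v := Finset.mem_filter.2 ⟨hy, ly⟩
    simpa [hU] using this
  grind

theorem PreFlow.degOK.eq_of_up {F : PreFlow} (h : F.degOK) {v : ℕ} (hv : v ∈ F.V)
    (h1 : (labDeg (F.η v)).1 = 1) {a x : ℕ} (ha : a ∈ F.E) (hx : x ∈ F.E)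
    (la : F.up a = some v) (lx : F.up x = some v) : x = a :=
  Finset.card_le_one.1 ((h v hv).1.trans h1).le x (Finset.mem_filter.2 ⟨hx, lx⟩) a
    (Finset.mem_filter.2 ⟨ha, la⟩)

theorem PreFlow.degOK.eq_of_lo {F : PreFlow} (h : F.degOK) {v : ℕ} (hv : v ∈ F.V)
    (h1 : (labDeg (F.η v)).2 = 1) {a x : ℕ} (ha : a ∈ F.E) (hx : x ∈ F.E)
    (la : F.lo a = some v) (lx : F.lo x = some v) : x = a :=
  Finset.card_le_one.1 ((h v hv).2.trans h1).le x (Finset.mem_filter.2 ⟨hx, lx⟩) a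
    (Finset.mem_filter.2 ⟨ha, la⟩)

theorem PreFlow.degOK.up_ne {F : PreFlow} (h : F.degOK) {v : ℕ} (hv : v ∈ F.V)
    (h0 : (labDeg (F.η v)).1 = 0) {x : ℕ} (hx : x ∈ F.E) : F.up x ≠ some v := fun lx => by
  have := Finset.card_eq_zero.1 ((h v hv).1.trans h0)
  exact Finset.notMem_empty x (this ▸ Finset.mem_filter.2 ⟨hx, lx⟩)

theorem PreFlow.degOK.lo_ne {F : PreFlow} (h : F.degOK) {v : ℕ} (hv : v ∈ F.V)
    (h0 : (labDeg (F.η v)).2 = 0) {x : ℕ} (hx : x ∈ F.E) : F.lo x ≠ some v := fun lx => by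
  have := Finset.card_eq_zero.1 ((h v hv).2.trans h0)
  exact Finset.notMem_empty x (this ▸ Finset.mem_filter.2 ⟨hx, lx⟩)

theorem IsWeighting.acDown_edges {F : PreFlow} {π : ℕ → Bool} {z q : ℕ → ℕ}
    (hW : IsWeighting F π z q) (hF : F.degOK) {v a b c : ℕ} (hv : v ∈ F.V)
    (hl : F.η v = .acDown) (ha : a ∈ F.E) (hb : b ∈ F.E) (hc : c ∈ F.E) (hab : a ≠ b)
    (la : F.lo a = some v) (lb : F.lo b = some v) (uc : F.up c = some v) :
    π a = π c ∧ π b = π c ∧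
    (π c = true → MergeAt z q a b c) ∧ (π c = false → SplitAt z q c a b) := by
  obtain ⟨a', ha', b', hb', c', hc', hab', la', lb', uc', p1, p2, p3, p4⟩ :=
    (hW.weightedAt v hv).acDown hl
  have h1 := hF.eq_or_eq_of_lo hv (by simp [hl, labDeg]) ha hb ha' hab la lb la'
  have h2 := hF.eq_or_eq_of_lo hv (by simp [hl, labDeg]) ha hb hb' hab la lb lb'
  have h3 := hF.eq_of_up hv (by simp [hl, labDeg]) hc hc' uc uc'
  unfold MergeAt SplitAt at *
  grind

theorem IsWeighting.acUp_edges {F : PreFlow} {π : ℕ → Bool} {z q : ℕ → ℕ}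
    (hW : IsWeighting F π z q) (hF : F.degOK) {v a b c : ℕ} (hv : v ∈ F.V)
    (hl : F.η v = .acUp) (ha : a ∈ F.E) (hb : b ∈ F.E) (hc : c ∈ F.E) (hab : a ≠ b)
    (ua : F.up a = some v) (ub : F.up b = some v) (lc : F.lo c = some v) :
    π a = π c ∧ π b = π c ∧
    (π c = false → MergeAt z q a b c) ∧ (π c = true → SplitAt z q c a b) := by
  obtain ⟨a', ha', b', hb', c', hc', hab', la', lb', uc', p1, p2, p3, p4⟩ :=
    (hW.weightedAt v hv).acUp hl
  have h1 := hF.eq_or_eq_of_up hv (by simp [hl, labDeg]) ha hb ha' hab ua ub la'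
  have h2 := hF.eq_or_eq_of_up hv (by simp [hl, labDeg]) ha hb hb' hab ua ub lb'
  have h3 := hF.eq_of_lo hv (by simp [hl, labDeg]) hc hc' lc uc'
  unfold MergeAt SplitAt at *
  grind

theorem IsWeighting.aiUp_edges {F : PreFlow} {π : ℕ → Bool} {z q : ℕ → ℕ}
    (hW : IsWeighting F π z q) (hF : F.degOK) {v a b : ℕ} (hv : v ∈ F.V)
    (hl : F.η v = .aiUp) (ha : a ∈ F.E) (hb : b ∈ F.E) (hab : a ≠ b)
    (la : F.lo a = some v) (lb : F.lo b = some v) :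
    π b = !π a ∧ (π a = true → TurnAt z q a b) ∧ (π a = false → TurnAt z q b a) := by
  obtain ⟨a', ha', b', hb', la', lb', p1, p2, p3⟩ := (hW.weightedAt v hv).aiUp hl
  have h1 := hF.eq_or_eq_of_lo hv (by simp [hl, labDeg]) ha hb ha' hab la lb la'
  have h2 := hF.eq_or_eq_of_lo hv (by simp [hl, labDeg]) ha hb hb' hab la lb lb'
  unfold TurnAt at *
  grind

theorem IsWeightedAt.of_acDown {F : PreFlow} {π : ℕ → Bool} {z q : ℕ → ℕ} {v a b c : ℕ}
    (hl : F.η v = .acDown) (ha : a ∈ F.E) (hb : b ∈ F.E) (hc : c ∈ F.E) (hab : a ≠ b)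
    (la : F.lo a = some v) (lb : F.lo b = some v) (uc : F.up c = some v)
    (πa : π a = π c) (πb : π b = π c)
    (hm : π c = true → MergeAt z q a b c) (hs : π c = false → SplitAt z q c a b) :
    IsWeightedAt F π z q v where
  acDown _ := ⟨a, ha, b, hb, c, hc, hab, la, lb, uc, πa, πb, hm, hs⟩
  acUp h := by simp [hl] at h
  aiDown h := by simp [hl] at h
  aiUp h := by simp [hl] at h

theorem IsWeightedAt.of_acUp {F : PreFlow} {π : ℕ → Bool} {z q : ℕ → ℕ} {v a b c : ℕ}
    (hl : F.η v = .acUp) (ha : a ∈ F.E) (hb : b ∈ F.E) (hc : c ∈ F.E) (hab : a ≠ b)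
    (ua : F.up a = some v) (ub : F.up b = some v) (lc : F.lo c = some v)
    (πa : π a = π c) (πb : π b = π c)
    (hm : π c = false → MergeAt z q a b c) (hs : π c = true → SplitAt z q c a b) :
    IsWeightedAt F π z q v where
  acDown h := by simp [hl] at h
  acUp _ := ⟨a, ha, b, hb, c, hc, hab, ua, ub, lc, πa, πb, hm, hs⟩
  aiDown h := by simp [hl] at h
  aiUp h := by simp [hl] at h

theorem IsWeightedAt.of_aiUp {F : PreFlow} {π : ℕ → Bool} {z q : ℕ → ℕ} {v a b : ℕ}
    (hl : F.η v = .aiUp) (ha : a ∈ F.E) (hb : b ∈ F.E)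
    (la : F.lo a = some v) (lb : F.lo b = some v) (hπ : π b = !π a)
    (ht : π a = true → TurnAt z q a b) (ht' : π a = false → TurnAt z q b a) :
    IsWeightedAt F π z q v where
  acDown h := by simp [hl] at h
  acUp h := by simp [hl] at h
  aiDown h := by simp [hl] at h
  aiUp _ := by
    cases hπa : π a <;> rw [hπa] at hπ
    · exact ⟨b, hb, a, ha, lb, la, hπ, hπa, ht' hπa⟩
    · exact ⟨a, ha, b, hb, la, lb, hπa, hπ, ht hπa⟩

/-- Being weighted at a vertex only depends on the edges at this vertex. -/
theorem IsWeightedAt.congr {A B : PreFlow} {π π' : ℕ → Bool} {z z' q q' : ℕ → ℕ} {v : ℕ}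
    (h : IsWeightedAt A π z q v) (hη : B.η v = A.η v) (hπ : ∀ x ∈ A.E, π' x = π x)
    (hz : ∀ x ∈ A.E, z' x = z x) (hq : ∀ x ∈ A.E, q' x = q x)
    (hlo : ∀ x ∈ A.E, A.lo x = some v → x ∈ B.E ∧ B.lo x = some v)
    (hup : ∀ x ∈ A.E, A.up x = some v → x ∈ B.E ∧ B.up x = some v) :
    IsWeightedAt B π' z' q' v where
  acDown hl := by
    obtain ⟨a, ha, b, hb, c, hc, h⟩ := h.acDown (hη ▸ hl)
    refine ⟨a, by grind, b, by grind, c, by grind, ?_⟩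
    unfold MergeAt SplitAt at *
    grind
  acUp hl := by
    obtain ⟨a, ha, b, hb, c, hc, h⟩ := h.acUp (hη ▸ hl)
    refine ⟨a, by grind, b, by grind, c, by grind, ?_⟩
    unfold MergeAt SplitAt at *
    grind
  aiDown hl := by
    obtain ⟨a, ha, b, hb, h⟩ := h.aiDown (hη ▸ hl)
    refine ⟨a, by grind, b, by grind, ?_⟩
    unfold TurnAt at *
    grind
  aiUp hl := by
    obtain ⟨a, ha, b, hb, h⟩ := h.aiUp (hη ▸ hl)
    refine ⟨a, by grind, b, by grind, ?_⟩
    unfold TurnAt at *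
    grind

theorem active_iff_of_pos {F : PreFlow} {π : ℕ → Bool} {e v : ℕ} (hπ : π e = true)
    (hv : F.lo e = some v) : Active F π e ↔ F.η v = .aiUp ∨ F.η v = .acUp := by
  simp [Active, hπ, hv]

theorem active_iff_of_neg {F : PreFlow} {π : ℕ → Bool} {e v : ℕ} (hπ : π e = false)
    (hv : F.up e = some v) : Active F π e ↔ F.η v = .aiDown ∨ F.η v = .acDown := by
  simp [Active, hπ, hv]

theorem edgeWeight_of_active {F : PreFlow} {π : ℕ → Bool} {z q : ℕ → ℕ} {x : ℕ}
    (h : Active F π x) : edgeWeight F π z q x = z x * q x := if_pos h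

theorem edgeWeight_of_not_active {F : PreFlow} {π : ℕ → Bool} {z q : ℕ → ℕ} {x : ℕ}
    (h : ¬ Active F π x) : edgeWeight F π z q x = 0 := if_neg h

theorem edgeWeight_congr {A B : PreFlow} {π π' : ℕ → Bool} {z z' q q' : ℕ → ℕ} {x : ℕ}
    (hπ : π' x = π x) (hz : z' x = z x) (hq : q' x = q x)
    (hlo : π x = true → B.lo x = A.lo x ∧ ∀ v, A.lo x = some v → B.η v = A.η v)
    (hup : π x = false → B.up x = A.up x ∧ ∀ v, A.up x = some v → B.η v = A.η v) :
    edgeWeight B π' z' q' x = edgeWeight A π z q x := by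
  have : Active B π' x ↔ Active A π x := by
    unfold Active
    rw [hπ]
    refine or_congr (and_congr_right fun h => ?_) (and_congr_right fun h => ?_)
    · rw [(hlo h).1]
      exact exists_congr fun v => and_congr_right fun hv => by rw [(hlo h).2 v hv]
    · rw [(hup h).1]
      exact exists_congr fun v => and_congr_right fun hv => by rw [(hup h).2 v hv]
  by_cases h : Active A π x
  · rw [edgeWeight_of_active h, edgeWeight_of_active (this.2 h), hz, hq]
  · rw [edgeWeight_of_not_active h, edgeWeight_of_not_active (this.not.2 h)]

theorem exists_extension {α : Type*} (f : ℕ → α) {S : Finset ℕ} {g₁ g₂ : ℕ} (hg : g₁ ≠ g₂)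
    (hg₁ : g₁ ∉ S) (hg₂ : g₂ ∉ S) (a b : α) :
    ∃ f' : ℕ → α, (∀ x ∈ S, f' x = f x) ∧ f' g₁ = a ∧ f' g₂ = b := by
  refine ⟨Function.update (Function.update f g₁ a) g₂ b, fun x hx => ?_, ?_, ?_⟩
  · rw [Function.update_of_ne (by rintro rfl; exact hg₂ hx),
      Function.update_of_ne (by rintro rfl; exact hg₁ hx)]
  · rw [Function.update_of_ne hg, Function.update_self]
  · rw [Function.update_self]

theorem exists_rest_cdIu {E : Finset ℕ} {e e₁ e₂ e₃ g₁ g₂ : ℕ} (hE : e ∈ E) (hE₁ : e₁ ∈ E)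
    (hE₂ : e₂ ∈ E) (hE₃ : e₃ ∈ E) (n01 : e ≠ e₁) (n02 : e ≠ e₂) (n03 : e ≠ e₃) (n12 : e₁ ≠ e₂)
    (n13 : e₁ ≠ e₃) (n23 : e₂ ≠ e₃) (hg₁ : g₁ ∉ E) (hg₂ : g₂ ∉ E) (hg : g₁ ≠ g₂) :
    ∃ R : Finset ℕ, (∀ x ∈ R, x ∈ E ∧ x ≠ e ∧ x ≠ e₁ ∧ x ≠ e₂ ∧ x ≠ e₃) ∧
      (∀ f : ℕ → ℕ, ∑ x ∈ E, f x = f e + f e₁ + f e₂ + f e₃ + ∑ x ∈ R, f x) ∧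
      ∀ f : ℕ → ℕ, ∑ x ∈ insert g₁ (insert g₂ (E.erase e)), f x =
        f g₁ + f g₂ + f e₁ + f e₂ + f e₃ + ∑ x ∈ R, f x := by
  have h1 : e₁ ∈ E.erase e := by grind
  have h2 : e₂ ∈ (E.erase e).erase e₁ := by grind
  have h3 : e₃ ∈ ((E.erase e).erase e₁).erase e₂ := by grind
  have key : ∀ f : ℕ → ℕ, ∑ x ∈ E.erase e, f x =
      f e₁ + f e₂ + f e₃ + ∑ x ∈ (((E.erase e).erase e₁).erase e₂).erase e₃, f x := fun f => by
    rw [← Finset.add_sum_erase _ f h1, ← Finset.add_sum_erase _ f h2,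
      ← Finset.add_sum_erase _ f h3]
    ring
  refine ⟨(((E.erase e).erase e₁).erase e₂).erase e₃, by grind, fun f => ?_, fun f => ?_⟩
  · rw [← Finset.add_sum_erase _ f hE, key]
    ring
  · rw [Finset.sum_insert (by grind), Finset.sum_insert (by grind), key]
    ring

theorem RedCdIu.exists_weighting {A B : PreFlow} (h : RedCdIu A B) (hd : A.degOK)
    (he : A.endpointsOK) {π : ℕ → Bool} {z q : ℕ → ℕ} (hW : IsWeighting A π z q) :
    ∃ π' z' q', IsWeighting B π' z' q' ∧ weight B π' z' q' < weight A π z q := by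
  obtain ⟨v₁, v₂, v₃, e, e₁, e₂, e₃, g₁, g₂, hv₁, hv₂, hv, hv₃, l₁, l₂, hE, hE₁, hE₂, hE₃,
    n01, n02, n03, n12, n13, n23, hg₁, hg₂, hg, lo₁, lo₂, up, lo, lo₃, hBV, hBE, hBη, hBup,
    hBlo⟩ := h
  obtain ⟨p1, p2, hm, hs⟩ := hW.acDown_edges hd hv₁ l₁ hE₁ hE₂ hE n12 lo₁ lo₂ up
  obtain ⟨p3, ht, ht'⟩ := hW.aiUp_edges hd hv₂ l₂ hE hE₃ n03 lo lo₃
  have ulo₁ : ∀ x ∈ A.E, A.lo x = some v₁ → x = e₁ ∨ x = e₂ := fun x hx lx =>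
    hd.eq_or_eq_of_lo hv₁ (by simp [l₁, labDeg]) hE₁ hE₂ hx n12 lo₁ lo₂ lx
  have ulo₂ : ∀ x ∈ A.E, A.lo x = some v₂ → x = e ∨ x = e₃ := fun x hx lx =>
    hd.eq_or_eq_of_lo hv₂ (by simp [l₂, labDeg]) hE hE₃ hx n03 lo lo₃ lx
  have uup₁ : ∀ x ∈ A.E, A.up x = some v₁ → x = e := fun x hx lx =>
    hd.eq_of_up hv₁ (by simp [l₁, labDeg]) hE hx up lx
  have uup₂ : ∀ x ∈ A.E, A.up x ≠ some v₂ := fun x hx =>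
    hd.up_ne hv₂ (by simp [l₂, labDeg]) hx
  have ulo₃ : ∀ x ∈ A.E, A.lo x ≠ some v₃ := fun x hx h => hv₃ ((he x hx).2 v₃ h)
  have uup₃ : ∀ x ∈ A.E, A.up x ≠ some v₃ := fun x hx h => hv₃ ((he x hx).1 v₃ h)
  have Bη₁ : B.η v₁ = .acUp := by
    rw [hBη, Function.update_of_ne (by rintro rfl; exact hv₃ hv₁), Function.update_self]
  have Bη₃ : B.η v₃ = .aiUp := by rw [hBη, Function.update_self]
  have Bη : ∀ v, v ≠ v₁ → v ≠ v₃ → B.η v = A.η v := fun v h1 h3 => by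
    rw [hBη, Function.update_of_ne h3, Function.update_of_ne h1]
  have ng : ∀ x ∈ A.E, x ≠ g₁ ∧ x ≠ g₂ := fun x hx =>
    ⟨fun h => hg₁ (h ▸ hx), fun h => hg₂ (h ▸ hx)⟩
  have Bup : ∀ x ∈ A.E, B.up x = A.up x := fun x hx => by
    rw [hBup, Function.update_of_ne (ng x hx).2, Function.update_of_ne (ng x hx).1]
  have Bug₁ : B.up g₁ = some v₁ := by simp [hBup, hg]
  have Bug₂ : B.up g₂ = some v₁ := by simp [hBup]
  have Blo : ∀ x ∈ A.E, x ≠ e₁ → x ≠ e₂ → x ≠ e₃ → B.lo x = A.lo x := fun x hx h1 h2 h3 => by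
    rw [hBlo, Function.update_of_ne (ng x hx).2, Function.update_of_ne (ng x hx).1,
      Function.update_of_ne h3, Function.update_of_ne h2, Function.update_of_ne h1]
  have Blo₁ : B.lo e₁ = some v₂ := by simp [hBlo, ng e₁ hE₁, n12, n13]
  have Blo₂ : B.lo e₂ = some v₃ := by simp [hBlo, ng e₂ hE₂, n23]
  have Blo₃ : B.lo e₃ = some v₁ := by simp [hBlo, ng e₃ hE₃]
  have Blg₁ : B.lo g₁ = some v₂ := by simp [hBlo, hg]
  have Blg₂ : B.lo g₂ = some v₃ := by simp [hBlo]
  have BE : ∀ x, x ∈ B.E ↔ x = g₁ ∨ x = g₂ ∨ (x ≠ e ∧ x ∈ A.E) := by simp [hBE]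
  have BV : ∀ v, v ∈ B.V ↔ v = v₃ ∨ v ∈ A.V := by simp [hBV]
  obtain ⟨π', hπ', πg₁, πg₂⟩ := exists_extension π hg hg₁ hg₂ (!π e) (!π e)
  obtain ⟨z', hz', zg₁, zg₂⟩ := exists_extension z hg hg₁ hg₂
    (if π e then 2 * z e₁ + 1 else z e₃) (if π e then 2 * z e₂ + 1 else z e₃)
  obtain ⟨q', hq', qg₁, qg₂⟩ := exists_extension q hg hg₁ hg₂ (q e₁) (q e₂)
  have pos := hW.pos
  have hq0 : ∀ x ∈ B.E, 0 < q' x := fun x hx => by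
    rcases (BE x).1 hx with rfl | rfl | ⟨-, h⟩
    · exact qg₁ ▸ pos _ hE₁
    · exact qg₂ ▸ pos _ hE₂
    · exact hq' x h ▸ pos x h
  have z1 := hz' e₁ hE₁
  have z2 := hz' e₂ hE₂
  have z3 := hz' e₃ hE₃
  have q1 := hq' e₁ hE₁
  have q2 := hq' e₂ hE₂
  have q3 := hq' e₃ hE₃
  have π1 := hπ' e₁ hE₁
  have π2 := hπ' e₂ hE₂
  have π3 := hπ' e₃ hE₃
  have ηup : ∀ x ∈ A.E, x ≠ e → ∀ v, A.up x = some v → B.η v = A.η v := fun x hx h v hxv =>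
    Bη v (fun hh => h (uup₁ x hx (hh ▸ hxv))) (fun hh => uup₃ x hx (hh ▸ hxv))
  have ηlo : ∀ x ∈ A.E, x ≠ e₁ → x ≠ e₂ → ∀ v, A.lo x = some v → B.η v = A.η v :=
    fun x hx h h' v hxv => Bη v (fun hh => (ulo₁ x hx (hh ▸ hxv)).elim h h')
      (fun hh => ulo₃ x hx (hh ▸ hxv))
  have Bη₂ : B.η v₂ = .aiUp := (ηlo e hE n01 n02 v₂ lo).trans l₂
  have BE₁ : e₁ ∈ B.E := (BE e₁).2 (.inr (.inr ⟨n01.symm, hE₁⟩))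
  have BE₂ : e₂ ∈ B.E := (BE e₂).2 (.inr (.inr ⟨n02.symm, hE₂⟩))
  have BE₃ : e₃ ∈ B.E := (BE e₃).2 (.inr (.inr ⟨n03.symm, hE₃⟩))
  have BG₁ : g₁ ∈ B.E := (BE g₁).2 (.inl rfl)
  have BG₂ : g₂ ∈ B.E := (BE g₂).2 (.inr (.inl rfl))
  unfold MergeAt at hm
  unfold SplitAt at hs
  unfold TurnAt at ht ht'
  refine ⟨π', z', q', ⟨hq0, fun v hv => ?_⟩, ?_⟩
  · by_cases h1 : v = v₁
    · subst h1
      refine .of_acUp Bη₁ BG₁ BG₂ BE₃ hg Bug₁ Bug₂ Blo₃ (by rw [πg₁, π3, p3])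
        (by rw [πg₂, π3, p3]) (fun h => ?_) (fun h => ?_) <;>
      · rw [π3, p3] at h
        simp only [MergeAt, SplitAt]
        clear * - hm hs ht ht' h zg₁ zg₂ z3 qg₁ qg₂ q3
        grind
    by_cases h2 : v = v₂
    · subst h2
      refine .of_aiUp Bη₂ BE₁ BG₁ Blo₁ Blg₁ (by rw [πg₁, π1, p1]) (fun h => ?_) (fun h => ?_) <;>
      · rw [π1, p1] at h
        unfold TurnAt
        clear * - hm hs ht ht' h zg₁ z1 qg₁ q1
        grind
    by_cases h3 : v = v₃
    · subst h3
      refine .of_aiUp Bη₃ BE₂ BG₂ Blo₂ Blg₂ (by rw [πg₂, π2, p2]) (fun h => ?_) (fun h => ?_) <;>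
      · rw [π2, p2] at h
        unfold TurnAt
        clear * - hm hs ht ht' h zg₂ z2 qg₂ q2
        grind
    refine (hW.weightedAt v (((BV v).1 hv).resolve_left h3)).congr (Bη v h1 h3) hπ' hz' hq'
      (fun x hx hxv => ?_) (fun x hx hxv => ?_)
    · clear * - hx hxv BE Blo lo₁ lo₂ lo lo₃ h1 h2
      grind
    · clear * - hx hxv BE Bup up h1
      grind
  · obtain ⟨R, hR, hsA, hsB⟩ :=
      exists_rest_cdIu hE hE₁ hE₂ hE₃ n01 n02 n03 n12 n13 n23 hg₁ hg₂ hg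
    have hsum : ∑ x ∈ R, edgeWeight B π' z' q' x = ∑ x ∈ R, edgeWeight A π z q x :=
      Finset.sum_congr rfl fun x hx => by
        obtain ⟨hx, h0, h1, h2, h3⟩ := hR x hx
        exact edgeWeight_congr (hπ' x hx) (hz' x hx) (hq' x hx)
          (fun _ => ⟨Blo x hx h1 h2 h3, ηlo x hx h1 h2⟩) (fun _ => ⟨Bup x hx, ηup x hx h0⟩)
    rw [weight, weight, hBE, hsA, hsB, hsum]
    have := pos e₁ hE₁
    have := pos e₂ hE₂
    have := pos e hE
    cases hπ : π e <;> rw [hπ] at p1 p2 p3 πg₁ πg₂ zg₁ zg₂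
    · obtain ⟨s1, s2, s3⟩ := hs hπ
      obtain ⟨t1, t2⟩ := ht' hπ
      have w0 : edgeWeight A π z q e = z e * q e :=
        edgeWeight_of_active ((active_iff_of_neg hπ up).2 (.inr l₁))
      have w1 : edgeWeight B π' z' q' e₁ = edgeWeight A π z q e₁ :=
        edgeWeight_congr π1 z1 q1 (by simp [p1]) fun _ => ⟨Bup e₁ hE₁, ηup e₁ hE₁ n01.symm⟩
      have w2 : edgeWeight B π' z' q' e₂ = edgeWeight A π z q e₂ :=
        edgeWeight_congr π2 z2 q2 (by simp [p2]) fun _ => ⟨Bup e₂ hE₂, ηup e₂ hE₂ n02.symm⟩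
      have w3 : edgeWeight B π' z' q' e₃ = z e₃ * q e₃ := by
        rw [edgeWeight_of_active ((active_iff_of_pos (π3.trans p3) Blo₃).2 (.inr Bη₁)), z3, q3]
      have w3' : edgeWeight A π z q e₃ = z e₃ * q e₃ :=
        edgeWeight_of_active ((active_iff_of_pos p3 lo₃).2 (.inl l₂))
      have w4 : edgeWeight B π' z' q' g₁ = z e₃ * q e₁ := by
        rw [edgeWeight_of_active ((active_iff_of_pos πg₁ Blg₁).2 (.inl Bη₂)), zg₁, qg₁]; rfl
      have w5 : edgeWeight B π' z' q' g₂ = z e₃ * q e₂ := by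
        rw [edgeWeight_of_active ((active_iff_of_pos πg₂ Blg₂).2 (.inl Bη₃)), zg₂, qg₂]; rfl
      rw [w0, w1, w2, w3, w3', w4, w5, t1, s3]
      linarith
    · obtain ⟨s1, s2, s3⟩ := hm hπ
      have w0 : edgeWeight A π z q e = z e * q e :=
        edgeWeight_of_active ((active_iff_of_pos hπ lo).2 (.inl l₂))
      have w1 : edgeWeight B π' z' q' e₁ = z e₁ * q e₁ := by
        rw [edgeWeight_of_active ((active_iff_of_pos (π1.trans p1) Blo₁).2 (.inl Bη₂)), z1, q1]
      have w2 : edgeWeight B π' z' q' e₂ = z e₂ * q e₂ := by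
        rw [edgeWeight_of_active ((active_iff_of_pos (π2.trans p2) Blo₂).2 (.inl Bη₃)), z2, q2]
      have w3 : edgeWeight B π' z' q' e₃ = edgeWeight A π z q e₃ :=
        edgeWeight_congr π3 z3 q3 (by simp [p3]) fun _ => ⟨Bup e₃ hE₃, ηup e₃ hE₃ n03.symm⟩
      have w4 : edgeWeight B π' z' q' g₁ = 0 :=
        edgeWeight_of_not_active (by simp [active_iff_of_neg πg₁ Bug₁, Bη₁])
      have w5 : edgeWeight B π' z' q' g₂ = 0 :=
        edgeWeight_of_not_active (by simp [active_iff_of_neg πg₂ Bug₂, Bη₁])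
      rw [w0, w1, w2, w3, w4, w5, s1, s2, s3]
      linarith

/-- The label of a vertex after turning the flow upside down. -/
def FlowLabel.dual : FlowLabel → FlowLabel
  | .aiDown => .aiUp
  | .aiUp => .aiDown
  | .awDown => .awUp
  | .awUp => .awDown
  | .acDown => .acUp
  | .acUp => .acDown

theorem FlowLabel.dual_dual (l : FlowLabel) : l.dual.dual = l := by cases l <;> rfl

theorem FlowLabel.dual_eq_iff {l l' : FlowLabel} : l.dual = l' ↔ l = l'.dual := by
  cases l <;> cases l' <;> simp [dual]

theorem labDeg_dual (l : FlowLabel) : labDeg l.dual = (labDeg l).swap := by cases l <;> rfl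

/-- The flow turned upside down. -/
def PreFlow.flip (F : PreFlow) : PreFlow where
  V := F.V
  E := F.E
  η v := (F.η v).dual
  up := F.lo
  lo := F.up

theorem PreFlow.flip_flip (F : PreFlow) : F.flip.flip = F := by
  simp [PreFlow.flip, FlowLabel.dual_dual]

theorem PreFlow.degOK.flip {F : PreFlow} (h : F.degOK) : F.flip.degOK := fun v hv => by
  change _ = (labDeg (F.η v).dual).1 ∧ _ = (labDeg (F.η v).dual).2
  rw [labDeg_dual]
  exact (h v hv).symm

theorem PreFlow.endpointsOK.flip {F : PreFlow} (h : F.endpointsOK) : F.flip.endpointsOK :=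
  fun e he => (h e he).symm

theorem RedIdCu.flip {A B : PreFlow} (h : RedIdCu A B) : RedCdIu A.flip B.flip := by
  obtain ⟨v₁, v₂, v₃, e, e₁, e₂, e₃, g₁, g₂, hv₁, hv₂, hv, hv₃, l₁, l₂, hE, hE₁, hE₂, hE₃,
    n01, n02, n03, n12, n13, n23, hg₁, hg₂, hg, up₁, up₂, lo, up, up₃, hBV, hBE, hBη, hBlo,
    hBup⟩ := h
  refine ⟨v₁, v₂, v₃, e, e₁, e₂, e₃, g₁, g₂, hv₁, hv₂, hv, hv₃, congrArg FlowLabel.dual l₁,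
    congrArg FlowLabel.dual l₂, hE, hE₁, hE₂, hE₃, n01, n02, n03, n12, n13, n23, hg₁, hg₂, hg,
    up₁, up₂, lo, up, up₃, hBV, hBE, ?_, hBlo, hBup⟩
  change FlowLabel.dual ∘ B.η = Function.update (Function.update (FlowLabel.dual ∘ A.η) _ _) _ _
  rw [hBη, Function.comp_update, Function.comp_update]
  rfl

theorem IsWeighting.flip {F : PreFlow} {π : ℕ → Bool} {z q : ℕ → ℕ}
    (h : IsWeighting F π z q) : IsWeighting F.flip (fun e => !π e) z q where
  pos := h.pos
  weightedAt v hv := by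
    have h := h.weightedAt v hv
    constructor <;> intro hl <;> replace hl := FlowLabel.dual_eq_iff.1 hl
    · obtain ⟨a, ha, b, hb, c, hc, hab, ua, ub, lc, h1, h2, h3, h4⟩ := h.acUp hl
      exact ⟨a, ha, b, hb, c, hc, hab, ua, ub, lc, by simp [h1], by simp [h2],
        by simpa using h3, by simpa using h4⟩
    · obtain ⟨a, ha, b, hb, c, hc, hab, la, lb, uc, h1, h2, h3, h4⟩ := h.acDown hl
      exact ⟨a, ha, b, hb, c, hc, hab, la, lb, uc, by simp [h1], by simp [h2],
        by simpa using h3, by simpa using h4⟩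
    · obtain ⟨a, ha, b, hb, la, lb, h1, h2, h3⟩ := h.aiUp hl
      exact ⟨a, ha, b, hb, la, lb, by simp [h1], by simp [h2], h3⟩
    · obtain ⟨a, ha, b, hb, ua, ub, h1, h2, h3⟩ := h.aiDown hl
      exact ⟨a, ha, b, hb, ua, ub, by simp [h1], by simp [h2], h3⟩

theorem active_flip {F : PreFlow} {π : ℕ → Bool} {e : ℕ} :
    Active F.flip (fun e => !π e) e ↔ Active F π e := by
  simp only [Active, PreFlow.flip, FlowLabel.dual_eq_iff]
  rw [or_comm]
  simp [FlowLabel.dual]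

theorem weight_flip (F : PreFlow) (π : ℕ → Bool) (z q : ℕ → ℕ) :
    weight F.flip (fun e => !π e) z q = weight F π z q :=
  Finset.sum_congr rfl fun _ _ => by
    classical exact if_congr active_flip rfl rfl

theorem RedIdCu.exists_weighting {A B : PreFlow} (h : RedIdCu A B) (hd : A.degOK)
    (he : A.endpointsOK) {π : ℕ → Bool} {z q : ℕ → ℕ} (hW : IsWeighting A π z q) :
    ∃ π' z' q', IsWeighting B π' z' q' ∧ weight B π' z' q' < weight A π z q := by
  obtain ⟨π', z', q', hW', hlt⟩ := h.flip.exists_weighting hd.flip he.flip hW.flip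
  refine ⟨_, z', q', B.flip_flip ▸ hW'.flip, ?_⟩
  rw [← weight_flip A, ← B.flip_flip, weight_flip B.flip]
  exact hlt

theorem exists_extension_four {α : Type*} (f : ℕ → α) {S : Finset ℕ} {g₁ g₂ g₃ g₄ : ℕ}
    (h12 : g₁ ≠ g₂) (h13 : g₁ ≠ g₃) (h14 : g₁ ≠ g₄) (h23 : g₂ ≠ g₃) (h24 : g₂ ≠ g₄)
    (h34 : g₃ ≠ g₄) (h1 : g₁ ∉ S) (h2 : g₂ ∉ S) (h3 : g₃ ∉ S) (h4 : g₄ ∉ S) (a b c d : α) :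
    ∃ f' : ℕ → α, (∀ x ∈ S, f' x = f x) ∧ f' g₁ = a ∧ f' g₂ = b ∧ f' g₃ = c ∧ f' g₄ = d := by
  obtain ⟨f₁, hS, ha, hb⟩ := exists_extension f h12 h1 h2 a b
  obtain ⟨f₂, hS', hc, hd⟩ := exists_extension f₁ (S := insert g₁ (insert g₂ S)) h34
    (by simp [h13.symm, h23.symm, h3]) (by simp [h14.symm, h24.symm, h4]) c d
  exact ⟨f₂, fun x hx => (hS' x (by simp [hx])).trans (hS x hx), (hS' g₁ (by simp)).trans ha,
    (hS' g₂ (by simp)).trans hb, hc, hd⟩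

theorem exists_rest_cdCu {E : Finset ℕ} {e e₁ e₂ e₃ e₄ g₁ g₂ g₃ g₄ : ℕ} (hE : e ∈ E)
    (hE₁ : e₁ ∈ E) (hE₂ : e₂ ∈ E) (hE₃ : e₃ ∈ E) (hE₄ : e₄ ∈ E) (n01 : e ≠ e₁) (n02 : e ≠ e₂)
    (n03 : e ≠ e₃) (n04 : e ≠ e₄) (n12 : e₁ ≠ e₂) (n13 : e₁ ≠ e₃) (n14 : e₁ ≠ e₄)
    (n23 : e₂ ≠ e₃) (n24 : e₂ ≠ e₄) (n34 : e₃ ≠ e₄) (h12 : g₁ ≠ g₂) (h13 : g₁ ≠ g₃)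
    (h14 : g₁ ≠ g₄) (h23 : g₂ ≠ g₃) (h24 : g₂ ≠ g₄) (h34 : g₃ ≠ g₄) (h1 : g₁ ∉ E)
    (h2 : g₂ ∉ E) (h3 : g₃ ∉ E) (h4 : g₄ ∉ E) :
    ∃ R : Finset ℕ, (∀ x ∈ R, x ∈ E ∧ x ≠ e ∧ x ≠ e₁ ∧ x ≠ e₂ ∧ x ≠ e₃ ∧ x ≠ e₄) ∧
      (∀ f : ℕ → ℕ, ∑ x ∈ E, f x = f e + (f e₁ + f e₂ + f e₃ + f e₄ + ∑ x ∈ R, f x)) ∧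
      ∀ f : ℕ → ℕ, ∑ x ∈ insert g₁ (insert g₂ (insert g₃ (insert g₄ (E.erase e)))), f x =
        f g₁ + f g₂ + f g₃ + f g₄ + (f e₁ + f e₂ + f e₃ + f e₄ + ∑ x ∈ R, f x) := by
  have m1 : e₁ ∈ E.erase e := by simp [n01.symm, hE₁]
  have m2 : e₂ ∈ (E.erase e).erase e₁ := by simp [n02.symm, n12.symm, hE₂]
  have m3 : e₃ ∈ ((E.erase e).erase e₁).erase e₂ := by
    simp [n03.symm, n13.symm, n23.symm, hE₃]
  have m4 : e₄ ∈ (((E.erase e).erase e₁).erase e₂).erase e₃ := by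
    simp [n04.symm, n14.symm, n24.symm, n34.symm, hE₄]
  have key : ∀ f : ℕ → ℕ, ∑ x ∈ E.erase e, f x = f e₁ + f e₂ + f e₃ + f e₄ +
      ∑ x ∈ ((((E.erase e).erase e₁).erase e₂).erase e₃).erase e₄, f x := fun f => by
    rw [← Finset.add_sum_erase _ f m1, ← Finset.add_sum_erase _ f m2,
      ← Finset.add_sum_erase _ f m3, ← Finset.add_sum_erase _ f m4]
    ring
  refine ⟨((((E.erase e).erase e₁).erase e₂).erase e₃).erase e₄, fun x hx => ?_, fun f => ?_,
    fun f => ?_⟩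
  · simp only [Finset.mem_erase] at hx
    tauto
  · rw [← Finset.add_sum_erase _ f hE, key]
  · rw [Finset.sum_insert (by simp [*]), Finset.sum_insert (by simp [*]),
      Finset.sum_insert (by simp [*]), Finset.sum_insert (by simp [*]), key]
    ring

theorem RedCdCu.exists_weighting {A B : PreFlow} (h : RedCdCu A B) (hd : A.degOK)
    (he : A.endpointsOK) {π : ℕ → Bool} {z q : ℕ → ℕ} (hW : IsWeighting A π z q) :
    ∃ π' z' q', IsWeighting B π' z' q' ∧ weight B π' z' q' < weight A π z q := by
  obtain ⟨v₁, v₂, v₃, v₄, e, e₁, e₂, e₃, e₄, g₁₁, g₁₂, g₂₁, g₂₂, hv₁, hv₂, hv, hv₃, hv₄, hv',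
    l₁, l₂, hE, hE₁, hE₂, hE₃, hE₄, n01, n02, n03, n04, n12, n13, n14, n23, n24, n34,
    hg₁, hg₂, hg₃, hg₄, h12, h13, h14, h23, h24, h34, lo₁, lo₂, up, lo, up₃, up₄,
    hBV, hBE, hBη, hBup, hBlo⟩ := h
  obtain ⟨p1, p2, hm, hs⟩ := hW.acDown_edges hd hv₁ l₁ hE₁ hE₂ hE n12 lo₁ lo₂ up
  obtain ⟨p3, p4, hm', hs'⟩ := hW.acUp_edges hd hv₂ l₂ hE₃ hE₄ hE n34 up₃ up₄ lo
  have ulo₁ : ∀ x ∈ A.E, A.lo x = some v₁ → x = e₁ ∨ x = e₂ := fun x hx lx =>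
    hd.eq_or_eq_of_lo hv₁ (by simp [l₁, labDeg]) hE₁ hE₂ hx n12 lo₁ lo₂ lx
  have uup₂ : ∀ x ∈ A.E, A.up x = some v₂ → x = e₃ ∨ x = e₄ := fun x hx lx =>
    hd.eq_or_eq_of_up hv₂ (by simp [l₂, labDeg]) hE₃ hE₄ hx n34 up₃ up₄ lx
  have uup₁ : ∀ x ∈ A.E, A.up x = some v₁ → x = e := fun x hx lx =>
    hd.eq_of_up hv₁ (by simp [l₁, labDeg]) hE hx up lx
  have ulo₂ : ∀ x ∈ A.E, A.lo x = some v₂ → x = e := fun x hx lx =>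
    hd.eq_of_lo hv₂ (by simp [l₂, labDeg]) hE hx lo lx
  have hlo : ∀ x ∈ A.E, ∀ v, A.lo x = some v → v ∈ A.V := fun x hx => (he x hx).2
  have hup : ∀ x ∈ A.E, ∀ v, A.up x = some v → v ∈ A.V := fun x hx => (he x hx).1
  have hne₃ : ∀ v ∈ A.V, v ≠ v₃ := fun v hvA h => hv₃ (h ▸ hvA)
  have hne₄ : ∀ v ∈ A.V, v ≠ v₄ := fun v hvA h => hv₄ (h ▸ hvA)
  have Bη₁ : B.η v₁ = .acUp := by
    rw [hBη, Function.update_of_ne (hne₄ v₁ hv₁),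
      Function.update_of_ne (hne₃ v₁ hv₁), Function.update_of_ne hv,
      Function.update_self]
  have Bη₂ : B.η v₂ = .acUp := by
    rw [hBη, Function.update_of_ne (hne₄ v₂ hv₂),
      Function.update_of_ne (hne₃ v₂ hv₂), Function.update_self]
  have Bη₃ : B.η v₃ = .acDown := by
    rw [hBη, Function.update_of_ne hv', Function.update_self]
  have Bη₄ : B.η v₄ = .acDown := by rw [hBη, Function.update_self]
  have Bη : ∀ v ∈ A.V, v ≠ v₁ → B.η v = A.η v := fun v hvA h1 => by
    by_cases h2 : v = v₂
    · rw [h2, Bη₂, l₂]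
    · rw [hBη, Function.update_of_ne (hne₄ v hvA),
        Function.update_of_ne (hne₃ v hvA), Function.update_of_ne h2,
        Function.update_of_ne h1]
  have ng : ∀ x ∈ A.E, x ≠ g₁₁ ∧ x ≠ g₁₂ ∧ x ≠ g₂₁ ∧ x ≠ g₂₂ := fun x hx =>
    ⟨fun h => hg₁ (h ▸ hx), fun h => hg₂ (h ▸ hx), fun h => hg₃ (h ▸ hx), fun h => hg₄ (h ▸ hx)⟩
  have Bup : ∀ x ∈ A.E, x ≠ e₃ → x ≠ e₄ → B.up x = A.up x := fun x hx h3 h4 => by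
    obtain ⟨a, b, c, d⟩ := ng x hx
    rw [hBup, Function.update_of_ne d, Function.update_of_ne c, Function.update_of_ne b,
      Function.update_of_ne a, Function.update_of_ne h4, Function.update_of_ne h3]
  have Bup₃ : B.up e₃ = some v₃ := by simp [hBup, ng e₃ hE₃, n34]
  have Bup₄ : B.up e₄ = some v₄ := by simp [hBup, ng e₄ hE₄]
  have Bug₁₁ : B.up g₁₁ = some v₁ := by simp [hBup, h12, h13, h14]
  have Bug₁₂ : B.up g₁₂ = some v₁ := by simp [hBup, h23, h24]
  have Bug₂₁ : B.up g₂₁ = some v₂ := by simp [hBup, h34]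
  have Bug₂₂ : B.up g₂₂ = some v₂ := by simp [hBup]
  have Blo : ∀ x ∈ A.E, x ≠ e₂ → B.lo x = A.lo x := fun x hx h2 => by
    obtain ⟨a, b, c, d⟩ := ng x hx
    rw [hBlo, Function.update_of_ne d, Function.update_of_ne c, Function.update_of_ne b,
      Function.update_of_ne a, Function.update_of_ne h2]
  have Blo₁ : B.lo e₁ = some v₁ := (Blo e₁ hE₁ n12).trans lo₁
  have Blo₂ : B.lo e₂ = some v₂ := by simp [hBlo, ng e₂ hE₂]
  have Blg₁₁ : B.lo g₁₁ = some v₃ := by simp [hBlo, h12, h13, h14]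
  have Blg₁₂ : B.lo g₁₂ = some v₄ := by simp [hBlo, h23, h24]
  have Blg₂₁ : B.lo g₂₁ = some v₃ := by simp [hBlo, h34]
  have Blg₂₂ : B.lo g₂₂ = some v₄ := by simp [hBlo]
  have BE : ∀ x, x ∈ B.E ↔ x = g₁₁ ∨ x = g₁₂ ∨ x = g₂₁ ∨ x = g₂₂ ∨ (x ≠ e ∧ x ∈ A.E) := by
    simp [hBE]
  have BV : ∀ v, v ∈ B.V ↔ v = v₃ ∨ v = v₄ ∨ v ∈ A.V := by simp [hBV]
  have BEA : ∀ x ∈ A.E, x ≠ e → x ∈ B.E := fun x hx hxe => by simp [hBE, hx, hxe]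
  have BE₁ := BEA e₁ hE₁ n01.symm
  have BE₂ := BEA e₂ hE₂ n02.symm
  have BE₃ := BEA e₃ hE₃ n03.symm
  have BE₄ := BEA e₄ hE₄ n04.symm
  have BG₁₁ : g₁₁ ∈ B.E := by simp [hBE]
  have BG₁₂ : g₁₂ ∈ B.E := by simp [hBE]
  have BG₂₁ : g₂₁ ∈ B.E := by simp [hBE]
  have BG₂₂ : g₂₂ ∈ B.E := by simp [hBE]
  obtain ⟨π', hπ', πg₁₁, πg₁₂, πg₂₁, πg₂₂⟩ := exists_extension_four π h12 h13 h14 h23 h24 h34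
    hg₁ hg₂ hg₃ hg₄ (π e) (π e) (π e) (π e)
  obtain ⟨z', hz', zg₁₁, zg₁₂, zg₂₁, zg₂₂⟩ := exists_extension_four z h12 h13 h14 h23 h24 h34
    hg₁ hg₂ hg₃ hg₄ (if π e then z e₁ else z e₃) (if π e then z e₁ else z e₄)
    (if π e then z e₂ else z e₃) (if π e then z e₂ else z e₄)
  obtain ⟨q', hq', qg₁₁, qg₁₂, qg₂₁, qg₂₂⟩ := exists_extension_four q h12 h13 h14 h23 h24 h34
    hg₁ hg₂ hg₃ hg₄ (if π e then q e₃ else q e₁) (if π e then q e₄ else q e₁)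
    (if π e then q e₃ else q e₂) (if π e then q e₄ else q e₂)
  have pos := hW.pos
  have r1 := pos e₁ hE₁
  have r2 := pos e₂ hE₂
  have r3 := pos e₃ hE₃
  have r4 := pos e₄ hE₄
  have hq0 : ∀ x ∈ B.E, 0 < q' x := fun x hx => by
    rcases (BE x).1 hx with rfl | rfl | rfl | rfl | ⟨-, h⟩
    · rw [qg₁₁]; split <;> assumption
    · rw [qg₁₂]; split <;> assumption
    · rw [qg₂₁]; split <;> assumption
    · rw [qg₂₂]; split <;> assumption
    · exact hq' x h ▸ pos x h
  have z1 := hz' e₁ hE₁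
  have z2 := hz' e₂ hE₂
  have z3 := hz' e₃ hE₃
  have z4 := hz' e₄ hE₄
  have q1 := hq' e₁ hE₁
  have q2 := hq' e₂ hE₂
  have q3 := hq' e₃ hE₃
  have q4 := hq' e₄ hE₄
  have π1 := (hπ' e₁ hE₁).trans p1
  have π2 := (hπ' e₂ hE₂).trans p2
  have π3 := (hπ' e₃ hE₃).trans p3
  have π4 := (hπ' e₄ hE₄).trans p4
  have ηup : ∀ x ∈ A.E, x ≠ e → ∀ v, A.up x = some v → B.η v = A.η v := fun x hx h v hxv =>
    Bη v (hup x hx v hxv) (fun hh => h (uup₁ x hx (hh ▸ hxv)))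
  have ηlo : ∀ x ∈ A.E, x ≠ e₁ → x ≠ e₂ → ∀ v, A.lo x = some v → B.η v = A.η v :=
    fun x hx h h' v hxv => Bη v (hlo x hx v hxv)
      (fun hh => (ulo₁ x hx (hh ▸ hxv)).elim h h')
  unfold MergeAt at hm hm'
  unfold SplitAt at hs hs'
  refine ⟨π', z', q', ⟨hq0, fun v hvB => ?_⟩, ?_⟩
  · by_cases h1 : v = v₁
    · subst h1
      refine .of_acUp Bη₁ BG₁₁ BG₁₂ BE₁ h12 Bug₁₁ Bug₁₂ Blo₁ (by rw [πg₁₁, π1])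
        (by rw [πg₁₂, π1]) (fun h => ?_) (fun h => ?_) <;>
      · rw [π1] at h
        simp only [MergeAt, SplitAt]
        clear * - hm hs hm' hs' h zg₁₁ zg₁₂ z1 qg₁₁ qg₁₂ q1
        grind
    by_cases h2 : v = v₂
    · subst h2
      refine .of_acUp Bη₂ BG₂₁ BG₂₂ BE₂ h34 Bug₂₁ Bug₂₂ Blo₂ (by rw [πg₂₁, π2])
        (by rw [πg₂₂, π2]) (fun h => ?_) (fun h => ?_) <;>
      · rw [π2] at h
        simp only [MergeAt, SplitAt]
        clear * - hm hs hm' hs' h zg₂₁ zg₂₂ z2 qg₂₁ qg₂₂ q2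
        grind
    by_cases h3 : v = v₃
    · subst h3
      refine .of_acDown Bη₃ BG₁₁ BG₂₁ BE₃ h13 Blg₁₁ Blg₂₁ Bup₃ (by rw [πg₁₁, π3])
        (by rw [πg₂₁, π3]) (fun h => ?_) (fun h => ?_) <;>
      · rw [π3] at h
        simp only [MergeAt, SplitAt]
        clear * - hm hs hm' hs' h zg₁₁ zg₂₁ z3 qg₁₁ qg₂₁ q3
        grind
    by_cases h4 : v = v₄
    · subst h4
      refine .of_acDown Bη₄ BG₁₂ BG₂₂ BE₄ h24 Blg₁₂ Blg₂₂ Bup₄ (by rw [πg₁₂, π4])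
        (by rw [πg₂₂, π4]) (fun h => ?_) (fun h => ?_) <;>
      · rw [π4] at h
        simp only [MergeAt, SplitAt]
        clear * - hm hs hm' hs' h zg₁₂ zg₂₂ z4 qg₁₂ qg₂₂ q4
        grind
    have hvA := (((BV v).1 hvB).resolve_left h3).resolve_left h4
    refine (hW.weightedAt v hvA).congr (Bη v hvA h1) hπ' hz' hq'
      (fun x hx hxv => ?_) (fun x hx hxv => ?_)
    · clear * - hx hxv BEA Blo lo₁ lo₂ lo h1 h2
      grind
    · clear * - hx hxv BEA Bup up up₃ up₄ h1 h2
      grind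
  · obtain ⟨R, hR, hsA, hsB⟩ := exists_rest_cdCu hE hE₁ hE₂ hE₃ hE₄ n01 n02 n03 n04 n12 n13 n14
      n23 n24 n34 h12 h13 h14 h23 h24 h34 hg₁ hg₂ hg₃ hg₄
    have hsum : ∑ x ∈ R, edgeWeight B π' z' q' x = ∑ x ∈ R, edgeWeight A π z q x :=
      Finset.sum_congr rfl fun x hx => by
        obtain ⟨hx, h0, h1, h2, h3, h4⟩ := hR x hx
        exact edgeWeight_congr (hπ' x hx) (hz' x hx) (hq' x hx)
          (fun _ => ⟨Blo x hx h2, ηlo x hx h1 h2⟩) (fun _ => ⟨Bup x hx h3 h4, ηup x hx h0⟩)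
    rw [weight, weight, hBE, hsA, hsB, hsum]
    have r0 := pos e hE
    cases hπ : π e <;> rw [hπ] at p1 p2 p3 p4 π1 π2 π3 π4 πg₁₁ πg₁₂ πg₂₁ πg₂₂
    · obtain ⟨s1, s2, s3⟩ := hs hπ
      obtain ⟨t1, t2, t3⟩ := hm' hπ
      have w0 : edgeWeight A π z q e = z e * q e :=
        edgeWeight_of_active ((active_iff_of_neg hπ up).2 (.inr l₁))
      have w1 : edgeWeight B π' z' q' e₁ = edgeWeight A π z q e₁ :=
        edgeWeight_congr (hπ' e₁ hE₁) z1 q1 (by simp [p1]) fun _ =>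
          ⟨Bup e₁ hE₁ n13 n14, ηup e₁ hE₁ n01.symm⟩
      have w2 : edgeWeight B π' z' q' e₂ = edgeWeight A π z q e₂ :=
        edgeWeight_congr (hπ' e₂ hE₂) z2 q2 (by simp [p2]) fun _ =>
          ⟨Bup e₂ hE₂ n23 n24, ηup e₂ hE₂ n02.symm⟩
      have w3 : edgeWeight B π' z' q' e₃ = z e₃ * q e₃ := by
        rw [edgeWeight_of_active ((active_iff_of_neg π3 Bup₃).2 (.inr Bη₃)), z3, q3]
      have w4 : edgeWeight B π' z' q' e₄ = z e₄ * q e₄ := by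
        rw [edgeWeight_of_active ((active_iff_of_neg π4 Bup₄).2 (.inr Bη₄)), z4, q4]
      have w11 : edgeWeight B π' z' q' g₁₁ = 0 :=
        edgeWeight_of_not_active (by simp [active_iff_of_neg πg₁₁ Bug₁₁, Bη₁])
      have w12 : edgeWeight B π' z' q' g₁₂ = 0 :=
        edgeWeight_of_not_active (by simp [active_iff_of_neg πg₁₂ Bug₁₂, Bη₁])
      have w21 : edgeWeight B π' z' q' g₂₁ = 0 :=
        edgeWeight_of_not_active (by simp [active_iff_of_neg πg₂₁ Bug₂₁, Bη₂])
      have w22 : edgeWeight B π' z' q' g₂₂ = 0 :=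
        edgeWeight_of_not_active (by simp [active_iff_of_neg πg₂₂ Bug₂₂, Bη₂])
      rw [w0, w1, w2, w3, w4, w11, w12, w21, w22, t1, t2, t3]
      linarith
    · obtain ⟨s1, s2, s3⟩ := hm hπ
      obtain ⟨t1, t2, t3⟩ := hs' hπ
      have w0 : edgeWeight A π z q e = z e * q e :=
        edgeWeight_of_active ((active_iff_of_pos hπ lo).2 (.inr l₂))
      have w1 : edgeWeight B π' z' q' e₁ = z e₁ * q e₁ := by
        rw [edgeWeight_of_active ((active_iff_of_pos π1 Blo₁).2 (.inr Bη₁)), z1, q1]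
      have w2 : edgeWeight B π' z' q' e₂ = z e₂ * q e₂ := by
        rw [edgeWeight_of_active ((active_iff_of_pos π2 Blo₂).2 (.inr Bη₂)), z2, q2]
      have w3 : edgeWeight B π' z' q' e₃ = edgeWeight A π z q e₃ :=
        edgeWeight_congr (hπ' e₃ hE₃) z3 q3 (fun _ => ⟨Blo e₃ hE₃ n23.symm,
          ηlo e₃ hE₃ n13.symm n23.symm⟩) (by simp [p3])
      have w4 : edgeWeight B π' z' q' e₄ = edgeWeight A π z q e₄ :=
        edgeWeight_congr (hπ' e₄ hE₄) z4 q4 (fun _ => ⟨Blo e₄ hE₄ n24.symm,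
          ηlo e₄ hE₄ n14.symm n24.symm⟩) (by simp [p4])
      have w11 : edgeWeight B π' z' q' g₁₁ = 0 :=
        edgeWeight_of_not_active (by simp [active_iff_of_pos πg₁₁ Blg₁₁, Bη₃])
      have w12 : edgeWeight B π' z' q' g₁₂ = 0 :=
        edgeWeight_of_not_active (by simp [active_iff_of_pos πg₁₂ Blg₁₂, Bη₄])
      have w21 : edgeWeight B π' z' q' g₂₁ = 0 :=
        edgeWeight_of_not_active (by simp [active_iff_of_pos πg₂₁ Blg₂₁, Bη₃])
      have w22 : edgeWeight B π' z' q' g₂₂ = 0 :=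
        edgeWeight_of_not_active (by simp [active_iff_of_pos πg₂₂ Blg₂₂, Bη₄])
      rw [w0, w1, w2, w3, w4, w11, w12, w21, w22, s1, s2, s3]
      linarith

/-- The vertex an edge leaves when positive edges point down and negative edges point up. -/
def orientedTail (F : PreFlow) (π : ℕ → Bool) (e : ℕ) : Option ℕ :=
  if π e then F.up e else F.lo e

/-- The vertex an edge enters when positive edges point down and negative edges point up. -/
def orientedHead (F : PreFlow) (π : ℕ → Bool) (e : ℕ) : Option ℕ :=
  if π e then F.lo e else F.up e

/-- The oriented edge `e` enters a vertex that the oriented edge `e'` leaves. -/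
def Follows (F : PreFlow) (π : ℕ → Bool) (e e' : ℕ) : Prop :=
  e ∈ F.E ∧ e' ∈ F.E ∧ ∃ v ∈ F.V, orientedHead F π e = some v ∧ orientedTail F π e' = some v

theorem eq_or_isAI_of_follows {F : PreFlow} {π : ℕ → Bool} (hd : F.degOK)
    (hp : F.PolarityOK π) {e e' v : ℕ} (he : e ∈ F.E) (he' : e' ∈ F.E) (hv : v ∈ F.V)
    (hh : orientedHead F π e = some v) (ht : orientedTail F π e' = some v) :
    π e = π e' ∨ (F.η v = .aiDown ∨ F.η v = .aiUp) ∧ π e' ≠ π e := by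
  by_cases h : π e = π e'
  · exact .inl h
  refine .inr ⟨?_, Ne.symm h⟩
  have mem : ∀ x ∈ F.E, F.up x = some v ∨ F.lo x = some v → x ∈ F.edges v := fun x hx hxv => by
    simpa [PreFlow.edges, PreFlow.Ledges, PreFlow.Uedges, hx] using hxv
  have me : e ∈ F.edges v := mem e he (by unfold orientedHead at hh; grind)
  have me' : e' ∈ F.edges v := mem e' he' (by unfold orientedTail at ht; grind)
  have hee : e ≠ e' := fun hh => h (congrArg π hh)
  have lo0 := hd.lo_ne hv
  have up0 := hd.up_ne hv
  have lo1 := hd.eq_of_lo (a := e) (x := e') hv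
  have up1 := hd.eq_of_up (a := e) (x := e') hv
  unfold orientedHead at hh
  unfold orientedTail at ht
  cases hl : F.η v with
  | aiDown => simp
  | aiUp => simp
  | acDown => exact absurd ((hp v hv).1 (.inl hl) e me e' me') h
  | acUp => exact absurd ((hp v hv).1 (.inr hl) e me e' me') h
  | awDown => simp only [hl, labDeg] at lo0 up1; grind
  | awUp => simp only [hl, labDeg] at up0 lo1; grind

theorem isDownPath_singleton {F : PreFlow} {ν ν' : VPt} {e : ℕ} (he : e ∈ F.E)
    (hs : srcOK F ν e) (ht : tgtOK F ν' e) : IsDownPath F ν ν' [e] :=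
  ⟨by simp, by simpa, by simp, hs, ht⟩

theorem IsDownPath.append {F : PreFlow} {ν ν' : VPt} {v : ℕ} {l l' : List ℕ}
    (h : IsDownPath F ν (.ver v) l) (hv : v ∈ F.V) (h' : IsDownPath F (.ver v) ν' l') :
    IsDownPath F ν ν' (l ++ l') := by
  obtain ⟨h1, h2, h3, h4, h5⟩ := h
  obtain ⟨h1', h2', h3', h4', h5'⟩ := h'
  have p := List.length_pos_iff.2 h1
  have p' := List.length_pos_iff.2 h1'
  refine ⟨by simp [h1], fun e he => (List.mem_append.1 he).elim (h2 e) (h2' e), fun i hi => ?_,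
    ?_, ?_⟩
  · rw [List.length_append] at hi
    rcases lt_trichotomy (i + 1) l.length with hl | hl | hl
    · rw [List.getD_append _ _ _ _ hl, List.getD_append _ _ _ _ (by omega)]
      exact h3 i hl
    · rw [List.getD_append_right _ _ _ _ hl.ge, List.getD_append _ _ _ _ (by omega)]
      have : i = l.length - 1 := by omega
      rw [this, show l.length - 1 + 1 - l.length = 0 by omega]
      exact ⟨v, hv, h5, h4'⟩
    · rw [List.getD_append_right _ _ _ _ hl.le, List.getD_append_right _ _ _ _ (by omega),
        show i + 1 - l.length = i - l.length + 1 by omega]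
      exact h3' _ (by omega)
  · rwa [List.getD_append _ _ _ _ p]
  · rw [List.length_append, List.getD_append_right _ _ _ _ (by omega),
      show l.length + l'.length - 1 - l.length = l'.length - 1 by omega]
    exact h5'

/-- A path following the orientation along edges of polarity `p`. -/
def IsMonoPath (F : PreFlow) (π : ℕ → Bool) (p : Bool) (u w : ℕ) (s : List ℕ) : Prop :=
  (∀ x ∈ s, π x = p) ∧ s ≠ [] ∧
    if p then IsDownPath F (.ver u) (.ver w) s else IsDownPath F (.ver w) (.ver u) s.reverse

theorem isMonoPath_singleton {F : PreFlow} {π : ℕ → Bool} {u w e : ℕ} (he : e ∈ F.E)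
    (ht : orientedTail F π e = some u) (hh : orientedHead F π e = some w) :
    IsMonoPath F π (π e) u w [e] := by
  refine ⟨by simp, by simp, ?_⟩
  unfold orientedTail at ht
  unfold orientedHead at hh
  split_ifs at * with h
  · exact isDownPath_singleton he ht hh
  · exact isDownPath_singleton he hh ht

theorem IsMonoPath.append {F : PreFlow} {π : ℕ → Bool} {p : Bool} {u v w : ℕ} {s t : List ℕ}
    (h : IsMonoPath F π p u v s) (hv : v ∈ F.V) (h' : IsMonoPath F π p v w t) :
    IsMonoPath F π p u w (s ++ t) := by
  obtain ⟨h1, h2, h3⟩ := h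
  obtain ⟨h1', h2', h3'⟩ := h'
  refine ⟨fun x hx => (List.mem_append.1 hx).elim (h1 x) (h1' x), by simp [h2], ?_⟩
  split_ifs at * with h
  · exact h3.append hv h3'
  · rw [List.reverse_append]
    exact h3'.append hv h3

theorem IsMonoPath.aiPath {F : PreFlow} {π : ℕ → Bool} {p : Bool} {u w : ℕ} {s : List ℕ}
    (h : IsMonoPath F π p u w s) : AIPath F (.ver u) (.ver w) s := by
  obtain ⟨-, -, h⟩ := h
  refine .single ?_
  split_ifs at h
  · exact .inl h
  · exact .inr h

/-- A path along the orientation starts with a path of constant polarity, which either is the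
whole path or ends at an interaction or cointeraction. -/
theorem exists_mono_append_aiPath {F : PreFlow} {π : ℕ → Bool} (hd : F.degOK)
    (hp : F.PolarityOK π) {w : ℕ} : ∀ (l : List ℕ) (e u : ℕ), e ∈ F.E →
      (e :: l).IsChain (Follows F π) →
      orientedTail F π e = some u →
      orientedHead F π ((e :: l).getLast (List.cons_ne_nil e l)) = some w →
      AIPath F (.ver u) (.ver w) (e :: l) ∧
      (IsMonoPath F π (π e) u w (e :: l) ∨
        ∃ s e' t μ, e :: l = s ++ e' :: t ∧ μ ∈ F.V ∧ (F.η μ = .aiDown ∨ F.η μ = .aiUp) ∧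
          π e' ≠ π e ∧ IsMonoPath F π (π e) u μ s ∧ AIPath F (.ver μ) (.ver w) (e' :: t)) := by
  intro l
  have join : ∀ {e u l}, (IsMonoPath F π (π e) u w (e :: l) ∨
      ∃ s e' t μ, e :: l = s ++ e' :: t ∧ μ ∈ F.V ∧ (F.η μ = .aiDown ∨ F.η μ = .aiUp) ∧
        π e' ≠ π e ∧ IsMonoPath F π (π e) u μ s ∧ AIPath F (.ver μ) (.ver w) (e' :: t)) →
      AIPath F (.ver u) (.ver w) (e :: l) := by
    rintro e u l (h | ⟨s, e', t, μ, heq, hμ, hai, hne, hs, ht⟩)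
    · exact h.aiPath
    · rw [heq]
      have hs' := hs.aiPath
      rw [← List.dropLast_append_getLast hs.2.1] at hs' ⊢
      refine .join hμ hai hs' ht fun hh => hne ?_
      rw [← hh]
      exact hs.1 _ (List.getLast_mem _)
  induction l with
  | nil =>
    intro e u he _ ht hh
    have := isMonoPath_singleton he ht hh
    exact ⟨this.aiPath, .inl this⟩
  | cons e' l ih =>
    intro e u he hc ht hh
    rw [List.isChain_cons_cons] at hc
    obtain ⟨⟨-, he', v, hv, hev, hev'⟩, hc⟩ := hc
    rw [List.getLast_cons (List.cons_ne_nil e' l)] at hh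
    obtain ⟨hpath, hrest⟩ := ih e' v he' hc hev' hh
    have hmono := isMonoPath_singleton he ht hev
    refine (fun h => ⟨join h, h⟩) ?_
    rcases eq_or_isAI_of_follows hd hp he he' hv hev hev' with heq | ⟨hai, hne⟩
    · rw [← heq] at hrest
      rcases hrest with h | ⟨s, x, t, μ, hl, hμ, hai, hne, hs, hx⟩
      · exact .inl (hmono.append hv h)
      · exact .inr ⟨e :: s, x, t, μ, by rw [hl]; rfl, hμ, hai, hne, hmono.append hv hs, hx⟩
    · exact .inr ⟨[e], e', l, v, rfl, hv, hai, hne, hmono, hpath⟩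

theorem exists_append_of_not_nodup {α : Type*} : ∀ {l : List α}, ¬ l.Nodup →
    ∃ a x b c, l = a ++ x :: (b ++ x :: c)
  | [], h => absurd List.nodup_nil h
  | y :: l, h => by
    by_cases hy : y ∈ l
    · obtain ⟨b, c, rfl⟩ := List.append_of_mem hy
      exact ⟨[], y, b, c, rfl⟩
    · obtain ⟨a, x, b, c, rfl⟩ := exists_append_of_not_nodup (l := l) (fun hl => h (hl.cons hy))
      exact ⟨y :: a, x, b, c, rfl⟩

/-- A relation with a cycle has a cycle without repetitions. -/
theorem exists_nodup_isChain {α : Type*} {r : α → α → Prop} (n : ℕ) : ∀ (e : α) (l : List α),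
    l.length = n → (e :: (l ++ [e])).IsChain r →
    ∃ e l, (e :: l).Nodup ∧ (e :: (l ++ [e])).IsChain r := by
  induction n using Nat.strong_induction_on with
  | _ n ih =>
    rintro e l rfl h
    by_cases hn : (e :: l).Nodup
    · exact ⟨e, l, hn, h⟩
    obtain ⟨a, x, b, c, heq⟩ := exists_append_of_not_nodup hn
    have hlen := congrArg List.length heq
    simp only [List.length_cons, List.length_append] at hlen
    refine ih b.length (by omega) x b rfl (h.infix ⟨a, c ++ [e], ?_⟩)
    rw [show e :: (l ++ [e]) = e :: l ++ [e] from rfl, heq]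
    simp

theorem CycleFree.irrefl_transGen_follows {F : PreFlow} {π : ℕ → Bool} (hF : CycleFree F)
    (hd : F.degOK) (hp : F.PolarityOK π) (e : ℕ) : ¬ Relation.TransGen (Follows F π) e e := by
  intro h
  obtain ⟨c, hec, hce⟩ := Relation.TransGen.tail'_iff.1 h
  obtain ⟨l, hl, hlast⟩ := List.exists_isChain_cons_of_relationReflTransGen hec
  have hcyc : (e :: (l ++ [e])).IsChain (Follows F π) := by
    rw [← List.cons_append, List.isChain_append]
    refine ⟨hl, .singleton e, fun x hx y hy => ?_⟩
    rw [List.getLast?_eq_some_getLast (List.cons_ne_nil e l), hlast] at hx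
    simp only [Option.mem_def, Option.some.injEq, List.head?_cons] at hx hy
    exact hx ▸ hy ▸ hce
  obtain ⟨e, l, hn, hc⟩ := exists_nodup_isChain _ e l rfl hcyc
  rw [← List.cons_append, List.isChain_append] at hc
  obtain ⟨hc, -, hlast⟩ := hc
  obtain ⟨-, he, v, hv, hh, ht⟩ :=
    hlast _ (List.getLast?_eq_some_getLast (List.cons_ne_nil e l)) e rfl
  exact hF ⟨v, e :: l, hv, (exists_mono_append_aiPath hd hp l e v he hc ht hh).1, hn⟩

theorem wellFounded_of_finset {r : ℕ → ℕ → Prop} (S : Finset ℕ)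
    (hS : ∀ a b, r a b → a ∈ S ∧ b ∈ S) (hr : ∀ a, ¬ Relation.TransGen r a a) :
    WellFounded r := by
  have : IsStrictOrder ℕ (Relation.TransGen r) := { irrefl := hr, trans := fun _ _ _ => .trans }
  refine Subrelation.wf (fun {a b} h => ?_)
    (Set.wellFoundedOn_iff.1 (S.finite_toSet.wellFoundedOn (r := Relation.TransGen r)))
  exact ⟨.single h, hS a b h⟩

open Classical in
theorem exists_recursion {r : ℕ → ℕ → Prop} (hr : WellFounded r) (S : Finset ℕ)
    (G : ℕ → ℕ → ℕ) : ∃ z : ℕ → ℕ, ∀ e, z e = G e (∑ x ∈ S with r x e, z x) := by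
  refine ⟨hr.fix fun e z => G e (∑ x ∈ (S.filter (r · e)).attach,
    z x.1 (Finset.mem_filter.1 x.2).2), fun e => ?_⟩
  rw [hr.fix_eq]
  congr 1
  exact Finset.sum_attach (S.filter (r · e)) fun x => hr.fix _ x

/-- The forward propagation rule: `n` is the sum of the values on the edges entering the vertex
that the oriented edge `e` leaves. -/
def propagate (F : PreFlow) (π : ℕ → Bool) (e n : ℕ) : ℕ :=
  match (orientedTail F π e).map F.η with
  | some .aiDown | some .aiUp => 2 * n + 1
  | some .acDown => if π e then n + 1 else n
  | some .acUp => if π e then n else n + 1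
  | _ => 0

/-- The values `z` and `q` satisfy the propagation rules at the vertex `v`. -/
structure IsPropagatedAt (F : PreFlow) (π : ℕ → Bool) (z q : ℕ → ℕ) (v : ℕ) : Prop where
  forward : ∀ e ∈ F.E, orientedTail F π e = some v →
    z e = propagate F π e (∑ x ∈ F.E with orientedHead F π x = some v, z x)
  backward : ∀ e ∈ F.E, orientedHead F π e = some v →
    q e = max 1 (∑ x ∈ F.E with orientedTail F π x = some v, q x)
  pos : ∀ e, 0 < q e

theorem exists_isPropagatedAt {F : PreFlow} {π : ℕ → Bool} (hF : CycleFree F)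
    (hd : F.degOK) (hp : F.PolarityOK π) :
    ∃ z q, (∀ e, 0 < q e) ∧ ∀ v ∈ F.V, IsPropagatedAt F π z q v := by
  classical
  have irr := hF.irrefl_transGen_follows hd hp
  obtain ⟨z, hz⟩ := exists_recursion
    (wellFounded_of_finset F.E (fun a b h => ⟨h.1, h.2.1⟩) irr) F.E (propagate F π)
  obtain ⟨q, hq⟩ := exists_recursion (r := Function.swap (Follows F π))
    (wellFounded_of_finset F.E (fun a b h => ⟨h.2.1, h.1⟩)
      fun a h => irr a (Relation.transGen_swap.1 h)) F.E fun _ n => max 1 n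
  have pos : ∀ e, 0 < q e := fun e => (hq e).symm ▸ by omega
  refine ⟨z, q, pos, fun v hv => ⟨fun e he ht => ?_, fun e he hh => ?_, pos⟩⟩
  · rw [hz e]
    congr 2
    refine Finset.filter_congr fun x hx => ⟨?_, fun h => ⟨hx, he, v, hv, h, ht⟩⟩
    rintro ⟨-, -, w, -, h, hw⟩
    rw [h, ← hw, ht]
  · rw [hq e]
    congr 2
    refine Finset.filter_congr fun x hx => ⟨?_, fun h => ⟨he, hx, v, hv, hh, h⟩⟩
    rintro ⟨-, -, w, -, hw, h⟩
    rw [h, ← hw, hh]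

section

variable {F : PreFlow} {π : ℕ → Bool} {z q : ℕ → ℕ} {v : ℕ}

theorem IsPropagatedAt.mergeAt (h : IsPropagatedAt F π z q v) {a b c : ℕ} (hab : a ≠ b)
    (hin : F.E.filter (orientedHead F π · = some v) = {a, b})
    (hout : F.E.filter (orientedTail F π · = some v) = {c})
    (hl : F.η v = .acDown ∧ π c = true ∨ F.η v = .acUp ∧ π c = false) : MergeAt z q a b c := by
  have ha : a ∈ F.E ∧ orientedHead F π a = some v :=
    Finset.mem_filter.1 (hin.ge (by simp))
  have hb : b ∈ F.E ∧ orientedHead F π b = some v :=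
    Finset.mem_filter.1 (hin.ge (by simp))
  have hc : c ∈ F.E ∧ orientedTail F π c = some v :=
    Finset.mem_filter.1 (hout.ge (by simp))
  have pc := h.pos c
  refine ⟨?_, ?_, ?_⟩
  · rw [h.forward c hc.1 hc.2, hin, Finset.sum_pair hab, propagate, hc.2]
    rcases hl with ⟨h1, h2⟩ | ⟨h1, h2⟩ <;> simp [h1, h2]
  · rw [h.backward a ha.1 ha.2, hout, Finset.sum_singleton]
    omega
  · rw [h.backward b hb.1 hb.2, hout, Finset.sum_singleton]
    omega

theorem IsPropagatedAt.splitAt (h : IsPropagatedAt F π z q v) {a b c : ℕ} (hab : a ≠ b)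
    (hin : F.E.filter (orientedHead F π · = some v) = {c})
    (hout : F.E.filter (orientedTail F π · = some v) = {a, b})
    (hl : F.η v = .acDown ∧ π a = false ∧ π b = false ∨
      F.η v = .acUp ∧ π a = true ∧ π b = true) : SplitAt z q c a b := by
  have ha : a ∈ F.E ∧ orientedTail F π a = some v :=
    Finset.mem_filter.1 (hout.ge (by simp))
  have hb : b ∈ F.E ∧ orientedTail F π b = some v :=
    Finset.mem_filter.1 (hout.ge (by simp))
  have hc : c ∈ F.E ∧ orientedHead F π c = some v :=
    Finset.mem_filter.1 (hin.ge (by simp))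
  have pa := h.pos a
  refine ⟨?_, ?_, ?_⟩
  · rw [h.forward a ha.1 ha.2, hin, Finset.sum_singleton, propagate, ha.2]
    rcases hl with ⟨h1, h2, -⟩ | ⟨h1, h2, -⟩ <;> simp [h1, h2]
  · rw [h.forward b hb.1 hb.2, hin, Finset.sum_singleton, propagate, hb.2]
    rcases hl with ⟨h1, -, h2⟩ | ⟨h1, -, h2⟩ <;> simp [h1, h2]
  · rw [h.backward c hc.1 hc.2, hout, Finset.sum_pair hab]
    omega

theorem IsPropagatedAt.turnAt (h : IsPropagatedAt F π z q v) {a b : ℕ}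
    (hin : F.E.filter (orientedHead F π · = some v) = {a})
    (hout : F.E.filter (orientedTail F π · = some v) = {b})
    (hl : F.η v = .aiDown ∨ F.η v = .aiUp) : TurnAt z q a b := by
  have ha : a ∈ F.E ∧ orientedHead F π a = some v :=
    Finset.mem_filter.1 (hin.ge (by simp))
  have hb : b ∈ F.E ∧ orientedTail F π b = some v :=
    Finset.mem_filter.1 (hout.ge (by simp))
  have pb := h.pos b
  refine ⟨?_, ?_⟩
  · rw [h.forward b hb.1 hb.2, hin, Finset.sum_singleton, propagate, hb.2]
    rcases hl with h1 | h1 <;> simp [h1]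
  · rw [h.backward a ha.1 ha.2, hout, Finset.sum_singleton]
    omega

theorem IsPropagatedAt.isWeightedAt (h : IsPropagatedAt F π z q v) (hv : v ∈ F.V)
    (hd : F.degOK) (hp : F.PolarityOK π) : IsWeightedAt F π z q v := by
  obtain ⟨hL, hU⟩ := hd v hv
  obtain ⟨hpc, hpi⟩ := hp v hv
  have mL : ∀ x, x ∈ F.Ledges v ↔ x ∈ F.E ∧ F.up x = some v := fun x => Finset.mem_filter
  have mU : ∀ x, x ∈ F.Uedges v ↔ x ∈ F.E ∧ F.lo x = some v := fun x => Finset.mem_filter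
  have mE : ∀ x, x ∈ F.edges v ↔ x ∈ F.Ledges v ∨ x ∈ F.Uedges v := fun x => Finset.mem_union
  have mh : ∀ x, x ∈ F.E.filter (orientedHead F π · = some v) ↔
      if π x then x ∈ F.Uedges v else x ∈ F.Ledges v := fun x => by
    rw [Finset.mem_filter, orientedHead, mL, mU]; split <;> rfl
  have mt : ∀ x, x ∈ F.E.filter (orientedTail F π · = some v) ↔
      if π x then x ∈ F.Ledges v else x ∈ F.Uedges v := fun x => by
    rw [Finset.mem_filter, orientedTail, mL, mU]; split <;> rfl
  constructor <;> intro hl <;> rw [hl] at hL hU hpc hpi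
  · obtain ⟨c, hLc⟩ := Finset.card_eq_one.1 hL
    obtain ⟨a, b, hab, hUab⟩ := Finset.card_eq_two.1 hU
    rw [hLc] at mL mE mh mt
    rw [hUab] at mU mE mh mt
    simp only [Finset.mem_insert, Finset.mem_singleton] at mL mU mE mh mt
    have hpc := hpc (.inl rfl)
    have πa := hpc a ((mE a).2 (by simp)) c ((mE c).2 (by simp))
    have πb := hpc b ((mE b).2 (by simp)) c ((mE c).2 (by simp))
    obtain ⟨ha, la⟩ := (mU a).1 (by simp)
    obtain ⟨hb, lb⟩ := (mU b).1 (by simp)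
    obtain ⟨hc, uc⟩ := (mL c).1 rfl
    refine ⟨a, ha, b, hb, c, hc, hab, la, lb, uc, πa, πb, fun h1 => ?_, fun h1 => ?_⟩
    · refine h.mergeAt hab ?_ ?_ (.inl ⟨hl, h1⟩) <;> ext x <;> simp only [mh, mt] <;> grind
    · refine h.splitAt hab ?_ ?_ (.inl ⟨hl, πa.trans h1, πb.trans h1⟩) <;> ext x <;>
        simp only [mh, mt] <;> grind
  · obtain ⟨a, b, hab, hLab⟩ := Finset.card_eq_two.1 hL
    obtain ⟨c, hUc⟩ := Finset.card_eq_one.1 hU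
    rw [hLab] at mL mE mh mt
    rw [hUc] at mU mE mh mt
    simp only [Finset.mem_insert, Finset.mem_singleton] at mL mU mE mh mt
    have hpc := hpc (.inr rfl)
    have πa := hpc a ((mE a).2 (by simp)) c ((mE c).2 (by simp))
    have πb := hpc b ((mE b).2 (by simp)) c ((mE c).2 (by simp))
    obtain ⟨ha, ua⟩ := (mL a).1 (by simp)
    obtain ⟨hb, ub⟩ := (mL b).1 (by simp)
    obtain ⟨hc, lc⟩ := (mU c).1 rfl
    refine ⟨a, ha, b, hb, c, hc, hab, ua, ub, lc, πa, πb, fun h1 => ?_, fun h1 => ?_⟩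
    · refine h.mergeAt hab ?_ ?_ (.inr ⟨hl, h1⟩) <;> ext x <;> simp only [mh, mt] <;> grind
    · refine h.splitAt hab ?_ ?_ (.inr ⟨hl, πa.trans h1, πb.trans h1⟩) <;> ext x <;>
        simp only [mh, mt] <;> grind
  · have hU := Finset.card_eq_zero.1 hU
    have key : ∃ a b, π a = false ∧ π b = true ∧ F.Ledges v = {a, b} := by
      obtain ⟨s, t, hst, hLst⟩ := Finset.card_eq_two.1 hL
      obtain ⟨e₁, h₁, e₂, h₂, hne⟩ := hpi (.inl rfl)
      rw [mE, hU, hLst] at h₁ h₂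
      simp only [Finset.mem_insert, Finset.mem_singleton, Finset.notMem_empty, or_false] at h₁ h₂
      rw [hLst]
      cases hs : π s
      · exact ⟨s, t, hs, by grind, rfl⟩
      · exact ⟨t, s, by grind, hs, Finset.pair_comm s t⟩
    obtain ⟨a, b, πa, πb, hLab⟩ := key
    rw [hLab] at mL mh mt
    rw [hU] at mh mt
    simp only [Finset.mem_insert, Finset.mem_singleton, Finset.notMem_empty] at mL mh mt
    obtain ⟨ha, ua⟩ := (mL a).1 (by simp)
    obtain ⟨hb, ub⟩ := (mL b).1 (by simp)
    refine ⟨a, ha, b, hb, ua, ub, πa, πb, h.turnAt ?_ ?_ (.inl hl)⟩ <;> ext x <;>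
      simp only [mh, mt] <;> grind
  · have hL := Finset.card_eq_zero.1 hL
    have key : ∃ a b, π a = true ∧ π b = false ∧ F.Uedges v = {a, b} := by
      obtain ⟨s, t, hst, hUst⟩ := Finset.card_eq_two.1 hU
      obtain ⟨e₁, h₁, e₂, h₂, hne⟩ := hpi (.inr rfl)
      rw [mE, hL, hUst] at h₁ h₂
      simp only [Finset.mem_insert, Finset.mem_singleton, Finset.notMem_empty, false_or] at h₁ h₂
      rw [hUst]
      cases hs : π s
      · exact ⟨t, s, by grind, hs, Finset.pair_comm s t⟩
      · exact ⟨s, t, hs, by grind, rfl⟩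
    obtain ⟨a, b, πa, πb, hUab⟩ := key
    rw [hUab] at mU mh mt
    rw [hL] at mh mt
    simp only [Finset.mem_insert, Finset.mem_singleton, Finset.notMem_empty] at mU mh mt
    obtain ⟨ha, la⟩ := (mU a).1 (by simp)
    obtain ⟨hb, lb⟩ := (mU b).1 (by simp)
    refine ⟨a, ha, b, hb, la, lb, πa, πb, h.turnAt ?_ ?_ (.inr hl)⟩ <;> ext x <;>
      simp only [mh, mt] <;> grind

end

theorem CycleFree.exists_isWeighting {F : PreFlow} (hF : CycleFree F) (h : F.IsFlow) :
    ∃ π z q, IsWeighting F π z q := by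
  obtain ⟨hd, -, -, π, hp⟩ := h
  obtain ⟨z, q, pos, hzq⟩ := exists_isPropagatedAt hF hd hp
  exact ⟨π, z, q, fun e _ => pos e, fun v hv => (hzq v hv).isWeightedAt hv hd hp⟩

theorem StepC.exists_weighting {A B : PreFlow} (h : StepC A B) (hA : A.IsFlow)
    {π : ℕ → Bool} {z q : ℕ → ℕ} (hW : IsWeighting A π z q) :
    ∃ π' z' q', IsWeighting B π' z' q' ∧ weight B π' z' q' < weight A π z q := by
  rcases h with h | h | h
  · exact h.exists_weighting hA.1 hA.2.1 hW
  · exact h.exists_weighting hA.1 hA.2.1 hW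
  · exact h.exists_weighting hA.1 hA.2.1 hW

theorem IsWeighting.not_chain (N : ℕ) : ∀ {A : ℕ → PreFlow} {π : ℕ → Bool} {z q : ℕ → ℕ},
    (∀ n, (A n).IsFlow) → (∀ n, StepC (A n) (A (n + 1))) → IsWeighting (A 0) π z q →
    weight (A 0) π z q ≠ N := by
  induction N using Nat.strong_induction_on with
  | _ N ih =>
    rintro A π z q hA hs hW rfl
    obtain ⟨π', z', q', hW', hlt⟩ := (hs 0).exists_weighting (hA 0) hW
    exact ih _ hlt (A := fun n => A (n + 1)) (fun n => hA _) (fun n => hs _) hW' rfl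

/-- The flow rewriting system `c` is terminating on the
set of cycle-free atomic flows: there is no infinite chain
`A₁ →c A₂ →c A₃ →c ⋯` of atomic flows with `A₁` cycle-free. -/
theorem statement_9 :
    ¬ ∃ A : ℕ → PreFlow, (∀ n, (A n).IsFlow) ∧ CycleFree (A 0) ∧
        ∀ n, StepC (A n) (A (n + 1)) := by
  rintro ⟨A, hA, hc, hs⟩
  obtain ⟨π, z, q, hW⟩ := hc.exists_isWeighting (hA 0)
  exact hW.not_chain _ hA hs rfl

end AF
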